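/- Let ρ : [0,∞) → (0,∞) be continuous and nonincreasing with ∫_{ℝⁿ} ρ(|x|²) dx < ∞ and with t ↦ −log ρ(e^t) convex on ℝ, and let μ_ρ be the probability measure on ℝⁿ with density ρ(|x|²)/∫ρ(|y|²)dy with respect to Lebesgue measure. Then for all Borel probability measures ν₁, ν₂ on ℝⁿ, T_{ω̃_ρ}(ν₁,ν₂) ≤ H(ν₁|μ_ρ) + H(ν₂|μ_ρ), where ω̃_ρ(x,y) = log( ρ(|x·y|)² / (ρ(|x|²) ρ(|y|²)) ). -/

import Mathlib

open MeasureTheory Set Filter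
open scoped RealInnerProductSpace ENNReal Topology

/-- The set of couplings of two measures: measures on the product whose marginals are the
given measures. -/
def Coupling {α : Type*} [MeasurableSpace α] (ν₁ ν₂ : Measure α) :
    Set (Measure (α × α)) :=
  {π | π.map Prod.fst = ν₁ ∧ π.map Prod.snd = ν₂}

/-- The optimal transport cost `T_c(ν₁,ν₂) = inf { ∫ c dπ : π coupling of ν₁ and ν₂}`. -/
noncomputable def transportCost {α : Type*} [MeasurableSpace α]
    (c : α → α → ℝ≥0∞) (ν₁ ν₂ : Measure α) : ℝ≥0∞ :=
  ⨅ π ∈ Coupling ν₁ ν₂, ∫⁻ p, c p.1 p.2 ∂π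

open Classical in
/-- Relative entropy `H(ν|μ) = ∫ log (dν/dμ) dν` if `ν ≪ μ` (and the integral exists),
`+∞` otherwise.  For probability measures the negative part of the integrand is always
integrable, so the `+∞` convention for the non-integrable case is the correct one. -/
noncomputable def relEnt {α : Type*} [MeasurableSpace α] (ν μ : Measure α) : ℝ≥0∞ :=
  if ν ≪ μ ∧ Integrable (llr ν μ) ν then ENNReal.ofReal (∫ x, llr ν μ x ∂ν) else ⊤

theorem volume_add_volume_le_of_add_mem {A B C : Set ℝ} (hA : MeasurableSet A)
    (hB : MeasurableSet B) (hA0 : A.Nonempty) (hB0 : B.Nonempty)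
    (hC : ∀ a ∈ A, ∀ b ∈ B, a + b ∈ C) : volume A + volume B ≤ volume C := by
  have left : ∀ a ∈ A, volume B ≤ volume C := fun a ha => by
    rw [← measure_preimage_add volume (-a) B]
    exact measure_mono fun x hx => by simpa using hC a ha _ hx
  have right : ∀ b ∈ B, volume A ≤ volume C := fun b hb => by
    rw [← measure_preimage_add_right volume (-b) A]
    exact measure_mono fun x hx => by simpa using hC _ hx b hb
  by_cases hvA : volume A = 0
  · obtain ⟨a, ha⟩ := hA0
    simpa [hvA] using left a ha
  by_cases hvB : volume B = 0
  · obtain ⟨b, hb⟩ := hB0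
    simpa [hvB] using right b hb
  by_contra! hlt
  obtain ⟨r, hr, s, hs, hrs⟩ := ENNReal.exists_lt_add_of_lt_add hlt hvA hvB
  obtain ⟨K, hKA, hK, hrK⟩ := hA.exists_lt_isCompact hr
  obtain ⟨L, hLB, hL, hsL⟩ := hB.exists_lt_isCompact hs
  have hK0 : K.Nonempty := nonempty_of_measure_ne_zero (ne_bot_of_gt hrK)
  have hL0 : L.Nonempty := nonempty_of_measure_ne_zero (ne_bot_of_gt hsL)
  have ha := hK.sSup_mem hK0
  have hb := hL.sInf_mem hL0
  set a := sSup K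
  set b := sInf L
  have hdisj : AEDisjoint volume ((fun x => x + -b) ⁻¹' K) ((fun x => -a + x) ⁻¹' L) := by
    refine measure_mono_null (t := {a + b}) ?_ (by simp)
    rintro x ⟨hx1, hx2⟩
    have h1 := le_csSup hK.bddAbove hx1
    have h2 := csInf_le hL.bddBelow hx2
    simp only [mem_singleton_iff]
    change x + -b ≤ a at h1
    change b ≤ -a + x at h2
    linarith
  have hmL : MeasurableSet ((fun x => -a + x) ⁻¹' L) :=
    (measurable_const_add (-a)) hL.measurableSet
  have hsub : ((fun x => x + -b) ⁻¹' K) ∪ ((fun x => -a + x) ⁻¹' L) ⊆ C := by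
    rintro x (hx | hx)
    · simpa using hC _ (hKA hx) _ (hLB hb)
    · simpa using hC _ (hKA ha) _ (hLB hx)
  have := measure_mono (μ := volume) hsub
  rw [measure_union₀ hmL.nullMeasurableSet hdisj, measure_preimage_add,
    measure_preimage_add_right] at this
  exact absurd (hrs.trans ((ENNReal.add_lt_add hrK hsL).trans_le this)) (lt_irrefl _)

theorem lintegral_ofReal_eq_setLIntegral_Ioo {f : ℝ → ℝ} (hf : Measurable f) (hf0 : ∀ x, 0 ≤ f x)
    (hf1 : ∀ x, f x ≤ 1) :
    ∫⁻ x, ENNReal.ofReal (f x) = ∫⁻ t in Ioo (0 : ℝ) 1, volume {x | t < f x} := by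
  rw [lintegral_eq_lintegral_meas_lt volume (ae_of_all _ hf0) hf.aemeasurable]
  rw [← lintegral_indicator measurableSet_Ioi, ← lintegral_indicator measurableSet_Ioo]
  congr 1 with t
  by_cases ht : t < 1
  · simp [indicator, ht]
  · have : {x | t < f x} = ∅ := eq_empty_of_forall_notMem fun x hx =>
      ht (lt_of_lt_of_le hx (hf1 x))
    simp [indicator, this]

theorem lintegral_add_le_of_normalized {f g h : ℝ → ℝ} (hf : Measurable f) (hg : Measurable g)
    (hh : Measurable h) (hf0 : ∀ x, 0 ≤ f x) (hg0 : ∀ x, 0 ≤ g x) (hh0 : ∀ x, 0 ≤ h x)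
    (hf1 : ∀ x, f x ≤ 1) (hg1 : ∀ x, g x ≤ 1) (hfs : ∀ t < 1, ∃ x, t < f x)
    (hgs : ∀ t < 1, ∃ x, t < g x) (hfg : ∀ x y, f x * g y ≤ h ((x + y) / 2) ^ 2) :
    (∫⁻ x, ENNReal.ofReal (f x)) + ∫⁻ x, ENNReal.ofReal (g x)
      ≤ 2 * ∫⁻ x, ENNReal.ofReal (h x) := by
  rw [lintegral_ofReal_eq_setLIntegral_Ioo hf hf0 hf1,
    lintegral_ofReal_eq_setLIntegral_Ioo hg hg0 hg1,
    lintegral_eq_lintegral_meas_lt volume (ae_of_all _ hh0) hh.aemeasurable,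
    ← lintegral_add_left' , ← lintegral_const_mul']
  · refine (setLIntegral_mono' measurableSet_Ioo fun t ht => ?_).trans
      (lintegral_mono_set fun t ht => ht.1)
    have key := volume_add_volume_le_of_add_mem (A := {x | t < f x}) (B := {x | t < g x})
      (C := (fun x => (2 : ℝ)⁻¹ * x) ⁻¹' {x | t < h x}) (hf measurableSet_Ioi)
      (hg measurableSet_Ioi) (hfs t ht.2) (hgs t ht.2) ?_
    · rw [Real.volume_preimage_mul_left (by norm_num)] at key
      simpa using key
    · intro a ha b hb
      simp only [mem_ofPred_eq, mem_preimage] at *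
      have := hfg a b
      rw [show (2 : ℝ)⁻¹ * (a + b) = (a + b) / 2 by ring]
      refine lt_of_pow_lt_pow_left₀ 2 (hh0 _) (lt_of_lt_of_le ?_ this)
      rw [sq]
      exact mul_lt_mul'' ha hb ht.1.le ht.1.le
  · simp
  · refine Measurable.aemeasurable ?_
    exact Antitone.measurable fun s t hst => measure_mono fun x hx => lt_of_le_of_lt hst hx

theorem ENNReal.mul_le_sq_of_add_le {a b c : ℝ≥0∞} (h : a + b ≤ 2 * c) : a * b ≤ c ^ 2 := by
  by_cases hc : c = ⊤
  · simp [hc]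
  have hab : a + b ≠ ⊤ := ne_top_of_le_ne_top (ENNReal.mul_ne_top (by simp) hc) h
  rw [ENNReal.add_ne_top] at hab
  lift a to NNReal using hab.1
  lift b to NNReal using hab.2
  lift c to NNReal using hc
  norm_cast at *
  rw [← NNReal.coe_le_coe] at *
  push_cast at *
  nlinarith [sq_nonneg ((a : ℝ) - b), a.2, b.2, c.2, NNReal.coe_nonneg a,
    NNReal.coe_nonneg b, NNReal.coe_nonneg c,
    mul_self_le_mul_self (add_nonneg (NNReal.coe_nonneg a) (NNReal.coe_nonneg b)) h]

/-- The Prékopa–Leindler inequality on the real line, for bounded functions and weight `1/2`. -/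
theorem prekopa_leindler_real {f g h : ℝ → ℝ} (hf : Measurable f) (hg : Measurable g)
    (hh : Measurable h) (hf0 : ∀ x, 0 ≤ f x) (hg0 : ∀ x, 0 ≤ g x) (hh0 : ∀ x, 0 ≤ h x)
    (hfb : BddAbove (range f)) (hgb : BddAbove (range g))
    (hfg : ∀ x y, f x * g y ≤ h ((x + y) / 2) ^ 2) :
    (∫⁻ x, ENNReal.ofReal (f x)) * ∫⁻ x, ENNReal.ofReal (g x)
      ≤ (∫⁻ x, ENNReal.ofReal (h x)) ^ 2 := by
  set α := ⨆ x, f x with hα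
  set β := ⨆ x, g x with hβ
  have hfα : ∀ x, f x ≤ α := le_ciSup hfb
  have hgβ : ∀ x, g x ≤ β := le_ciSup hgb
  rcases ((hf0 0).trans (hfα 0)).eq_or_lt with h0 | hα0
  · have : ∀ x, f x = 0 := fun x => le_antisymm (h0 ▸ hfα x) (hf0 x)
    simp [this]
  rcases ((hg0 0).trans (hgβ 0)).eq_or_lt with h0 | hβ0
  · have : ∀ x, g x = 0 := fun x => le_antisymm (h0 ▸ hgβ x) (hg0 x)
    simp [this]
  set γ := √(α * β) with hγ
  have hγ0 : 0 < γ := Real.sqrt_pos.2 (mul_pos hα0 hβ0)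
  have hγ2 : γ ^ 2 = α * β := Real.sq_sqrt (mul_pos hα0 hβ0).le
  have key := lintegral_add_le_of_normalized (f := fun x => α⁻¹ * f x) (g := fun x => β⁻¹ * g x)
    (h := fun x => γ⁻¹ * h x) (hf.const_mul _) (hg.const_mul _) (hh.const_mul _)
    (fun x => mul_nonneg (inv_nonneg.2 hα0.le) (hf0 x))
    (fun x => mul_nonneg (inv_nonneg.2 hβ0.le) (hg0 x))
    (fun x => mul_nonneg (inv_nonneg.2 hγ0.le) (hh0 x))
    (fun x => by rw [inv_mul_le_iff₀ hα0]; simpa using hfα x)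
    (fun x => by rw [inv_mul_le_iff₀ hβ0]; simpa using hgβ x)
    (fun t ht => by
      obtain ⟨x, hx⟩ := exists_lt_of_lt_ciSup (show α * t < ⨆ x, f x by
        rw [← hα]; nlinarith)
      exact ⟨x, by rwa [lt_inv_mul_iff₀ hα0]⟩)
    (fun t ht => by
      obtain ⟨x, hx⟩ := exists_lt_of_lt_ciSup (show β * t < ⨆ x, g x by
        rw [← hβ]; nlinarith)
      exact ⟨x, by rwa [lt_inv_mul_iff₀ hβ0]⟩)
    (fun x y => by
      rw [mul_pow, inv_pow, hγ2, mul_mul_mul_comm, mul_inv]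
      exact mul_le_mul_of_nonneg_left (hfg x y) (by positivity))
  simp_rw [ENNReal.ofReal_mul (inv_nonneg.2 hα0.le), ENNReal.ofReal_mul (inv_nonneg.2 hβ0.le),
    ENNReal.ofReal_mul (inv_nonneg.2 hγ0.le)] at key
  rw [lintegral_const_mul' _ _ ENNReal.ofReal_ne_top,
    lintegral_const_mul' _ _ ENNReal.ofReal_ne_top,
    lintegral_const_mul' _ _ ENNReal.ofReal_ne_top] at key
  have key2 := ENNReal.mul_le_sq_of_add_le key
  rw [mul_pow, mul_mul_mul_comm, ← ENNReal.ofReal_pow (by positivity),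
    ← ENNReal.ofReal_mul (by positivity), inv_pow, hγ2, ← mul_inv] at key2
  have hne : ENNReal.ofReal (α * β)⁻¹ ≠ 0 :=
    (ENNReal.ofReal_pos.2 (inv_pos.2 (mul_pos hα0 hβ0))).ne'
  exact (ENNReal.mul_le_mul_iff_right hne ENNReal.ofReal_ne_top).1 key2

theorem lintegral_Ioi_eq_lintegral_exp (φ : ℝ → ℝ≥0∞) :
    ∫⁻ s in Ioi (0 : ℝ), φ s = ∫⁻ a, ENNReal.ofReal (Real.exp a) * φ (Real.exp a) := by
  have := lintegral_image_eq_lintegral_abs_deriv_mul MeasurableSet.univ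
    (fun x _ => (Real.hasDerivAt_exp x).hasDerivWithinAt) Real.exp_injective.injOn φ
  rw [image_univ, Real.range_exp] at this
  simpa [abs_of_pos (Real.exp_pos _)] using this

/-- The multiplicative (geometric mean) form of the Prékopa–Leindler inequality on the
half-line. -/
theorem prekopa_leindler_Ioi {f g h : ℝ → ℝ} (hf : Measurable f) (hg : Measurable g)
    (hh : Measurable h) (hf0 : ∀ x, 0 ≤ f x) (hg0 : ∀ x, 0 ≤ g x) (hh0 : ∀ x, 0 ≤ h x)
    {M N : ℝ} (hfb : ∀ s > 0, s * f s ≤ M) (hgb : ∀ s > 0, s * g s ≤ N)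
    (hfg : ∀ s > 0, ∀ t > 0, f s * g t ≤ h (√(s * t)) ^ 2) :
    (∫⁻ s in Ioi (0 : ℝ), ENNReal.ofReal (f s)) * ∫⁻ s in Ioi (0 : ℝ), ENNReal.ofReal (g s)
      ≤ (∫⁻ s in Ioi (0 : ℝ), ENNReal.ofReal (h s)) ^ 2 := by
  simp_rw [lintegral_Ioi_eq_lintegral_exp, ← ENNReal.ofReal_mul (Real.exp_pos _).le]
  refine prekopa_leindler_real (Real.measurable_exp.mul (hf.comp Real.measurable_exp))
    (Real.measurable_exp.mul (hg.comp Real.measurable_exp))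
    (Real.measurable_exp.mul (hh.comp Real.measurable_exp))
    (fun x => mul_nonneg (Real.exp_pos _).le (hf0 _))
    (fun x => mul_nonneg (Real.exp_pos _).le (hg0 _))
    (fun x => mul_nonneg (Real.exp_pos _).le (hh0 _))
    ⟨M, ?_⟩ ⟨N, ?_⟩ fun x y => ?_
  · rintro _ ⟨x, rfl⟩
    exact hfb _ (Real.exp_pos x)
  · rintro _ ⟨x, rfl⟩
    exact hgb _ (Real.exp_pos x)
  · have h1 : √(Real.exp x * Real.exp y) = Real.exp ((x + y) / 2) := by
      rw [← Real.exp_add, Real.exp_half]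
    have h2 : Real.exp x * Real.exp y = Real.exp ((x + y) / 2) ^ 2 := by
      rw [← Real.exp_add, sq, ← Real.exp_add]; ring_nf
    have h3 := hfg _ (Real.exp_pos x) _ (Real.exp_pos y)
    rw [h1] at h3
    rw [mul_mul_mul_comm, h2, mul_pow]
    exact mul_le_mul_of_nonneg_left h3 (by positivity)

/-- Nonnegative bounded measurable functions vanishing outside a bounded set. -/
structure IsTestDensity {E : Type*} [NormedAddCommGroup E] [MeasurableSpace E]
    (f : E → ℝ) : Prop where
  measurable : Measurable f
  nonneg : ∀ x, 0 ≤ f x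
  bdd : ∃ M, ∀ x, f x ≤ M
  supp : ∃ R, ∀ x, R < ‖x‖ → f x = 0

section

set_option linter.unusedSectionVars false

variable {E : Type*} [NormedAddCommGroup E] [NormedSpace ℝ E] [FiniteDimensional ℝ E]
  [MeasurableSpace E] [BorelSpace E] {F : Type*} [NormedAddCommGroup F] [NormedSpace ℝ F]
  [FiniteDimensional ℝ F] [MeasurableSpace F] [BorelSpace F]

/-- Functional Santaló inequality for centered functions with respect to a bilinear pairing. -/
def CenteredSantalo (μ : Measure E) (B : LinearMap.BilinForm ℝ E) (C : ℝ) : Prop :=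
  ∀ f g : E → ℝ, IsTestDensity f → IsTestDensity g → ∫ x, f x • x ∂μ = 0 →
    (∀ x y, f x * g y ≤ Real.exp (-2 * B x y)) → (∫ x, f x ∂μ) * ∫ x, g x ∂μ ≤ C

/-- Functional Santaló inequality with respect to a bilinear pairing, after a suitable
translation of one of the functions. -/
def TranslatedSantalo (μ : Measure E) (B : LinearMap.BilinForm ℝ E) (C : ℝ) : Prop :=
  ∀ g : E → ℝ, IsTestDensity g → ∃ z, ∀ f : E → ℝ, IsTestDensity f →
    (∀ x y, f x * g y ≤ Real.exp (-2 * B x (y - z))) → (∫ x, f x ∂μ) * ∫ x, g x ∂μ ≤ C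

namespace IsTestDensity

theorem comp {f : E → ℝ} (hf : IsTestDensity f) {φ : F → E} {ψ : E → F} (hφ : Continuous φ)
    (hψ : Continuous ψ) (h : ∀ x, ψ (φ x) = x) : IsTestDensity fun x => f (φ x) := by
  obtain ⟨M, hM⟩ := hf.bdd
  obtain ⟨R, hR⟩ := hf.supp
  refine ⟨hf.measurable.comp hφ.measurable, fun x => hf.nonneg _, ⟨M, fun x => hM _⟩, ?_⟩
  have : ProperSpace E := FiniteDimensional.proper ℝ E
  obtain ⟨R', hR'⟩ := ((isCompact_closedBall (0 : E) R).image hψ).isBounded.subset_closedBall 0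
  refine ⟨R', fun x hx => hR _ ?_⟩
  by_contra! hle
  have := hR' ⟨φ x, by simpa using hle, h x⟩
  simp only [Metric.mem_closedBall, dist_zero_right] at this
  linarith

theorem mul_continuous {f : E → ℝ} (hf : IsTestDensity f) {u : E → ℝ} (hu : Continuous u)
    (hu0 : ∀ x, 0 ≤ u x) : IsTestDensity fun x => f x * u x := by
  obtain ⟨M, hM⟩ := hf.bdd
  obtain ⟨R, hR⟩ := hf.supp
  have : ProperSpace E := FiniteDimensional.proper ℝ E
  obtain ⟨N, hN⟩ := ((isCompact_closedBall (0 : E) R).image hu).bddAbove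
  have hM0 : 0 ≤ M := (hf.nonneg 0).trans (hM 0)
  refine ⟨hf.measurable.mul hu.measurable, fun x => mul_nonneg (hf.nonneg x) (hu0 x),
    ⟨max 0 (M * N), fun x => ?_⟩, R, fun x hx => by simp [hR x hx]⟩
  by_cases hx : R < ‖x‖
  · simp [hR x hx]
  · refine le_max_of_le_right (mul_le_mul (hM x) (hN ⟨x, by simpa using hx, rfl⟩) (hu0 x) hM0)

theorem const_mul {f : E → ℝ} (hf : IsTestDensity f) {c : ℝ} (hc : 0 ≤ c) :
    IsTestDensity fun x => c * f x := by
  simpa [mul_comm] using hf.mul_continuous (continuous_const (y := c)) fun _ => hc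

theorem integrable_smul {V : Type*} [NormedAddCommGroup V] [NormedSpace ℝ V] {f : E → ℝ}
    (hf : IsTestDensity f) (μ : Measure E) [IsFiniteMeasureOnCompacts μ] {u : E → V}
    (hu : Continuous u) :
    Integrable (fun x => f x • u x) μ := by
  obtain ⟨M, hM⟩ := hf.bdd
  obtain ⟨R, hR⟩ := hf.supp
  have : ProperSpace E := FiniteDimensional.proper ℝ E
  have hcont : IntegrableOn (fun x => M * ‖u x‖) (Metric.closedBall 0 R) μ :=
    (continuous_const.mul hu.norm).continuousOn.integrableOn_compact (isCompact_closedBall _ _)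
  have h1 : IntegrableOn (fun x => f x • u x) (Metric.closedBall 0 R) μ := by
    refine hcont.mono' (hf.measurable.aestronglyMeasurable.smul hu.aestronglyMeasurable)
      (ae_of_all _ fun x => ?_)
    rw [norm_smul, Real.norm_of_nonneg (hf.nonneg x)]
    exact mul_le_mul_of_nonneg_right (hM x) (norm_nonneg _)
  refine (integrableOn_iff_integrable_of_support_subset fun x hx => ?_).1 h1
  by_contra h
  exact hx (by simp [hR x (by simpa using h)])

theorem integrable {f : E → ℝ} (hf : IsTestDensity f) (μ : Measure E)
    [IsFiniteMeasureOnCompacts μ] : Integrable f μ := by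
  simpa using hf.integrable_smul μ (continuous_const (y := (1 : ℝ)))

theorem slice {f : ℝ × E → ℝ} (hf : IsTestDensity f) (x : E) :
    IsTestDensity fun s => f (s, x) := by
  obtain ⟨M, hM⟩ := hf.bdd
  obtain ⟨R, hR⟩ := hf.supp
  refine ⟨hf.measurable.comp (by fun_prop), fun s => hf.nonneg _, ⟨M, fun s => hM _⟩,
    R, fun s hs => hR _ (hs.trans_le (le_max_left _ _))⟩

theorem slice_left {f : ℝ × E → ℝ} (hf : IsTestDensity f) (s : ℝ) :
    IsTestDensity fun x => f (s, x) := by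
  obtain ⟨M, hM⟩ := hf.bdd
  obtain ⟨R, hR⟩ := hf.supp
  refine ⟨hf.measurable.comp (by fun_prop), fun s => hf.nonneg _, ⟨M, fun s => hM _⟩,
    R, fun x hs => hR _ (hs.trans_le (le_max_right _ _))⟩

theorem setIntegral {f : ℝ × E → ℝ} (hf : IsTestDensity f) (S : Set ℝ) :
    IsTestDensity fun x => ∫ s in S, f (s, x) := by
  obtain ⟨M, hM⟩ := hf.bdd
  obtain ⟨R, hR⟩ := hf.supp
  have hM0 : 0 ≤ M := (hf.nonneg 0).trans (hM 0)
  have hm := hf.measurable.stronglyMeasurable.integral_prod_left' (μ := volume.restrict S)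
  refine ⟨hm.measurable, fun x => integral_nonneg fun s => hf.nonneg _,
    ⟨∫ s, (Icc (-R) R).indicator (fun _ => M) s, fun x => ?_⟩, R, fun x hx => ?_⟩
  · refine (setIntegral_le_integral ((hf.slice x).integrable volume)
      (ae_of_all _ fun s => hf.nonneg _)).trans (integral_mono ((hf.slice x).integrable volume)
        ?_ fun s => ?_)
    · exact (integrable_indicator_iff measurableSet_Icc).2 (integrableOn_const (by simp))
    · by_cases hs : s ∈ Icc (-R) R
      · simpa [hs] using hM _
      · rw [indicator_of_notMem hs]
        refine (hR _ (lt_of_lt_of_le ?_ (le_max_left _ _))).le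
        rw [mem_Icc, ← abs_le, not_le] at hs
        exact hs
  · have : ∀ s, f (s, x) = 0 := fun s => hR _ (hx.trans_le (le_max_right _ _))
    simp [this]

end IsTestDensity

theorem TranslatedSantalo.centered {μ : Measure E} [IsFiniteMeasureOnCompacts μ]
    {B : LinearMap.BilinForm ℝ E} {C : ℝ} (h : TranslatedSantalo μ B C)
    (hB : ∀ x y, B x y = B y x) :
    CenteredSantalo μ B C := by
  intro f g hf hg hf0 hfg
  obtain ⟨z, hz⟩ := h g hg
  have hBz : Continuous fun x => B x z := by
    simpa only [hB _ z] using (B z).continuous_of_finiteDimensional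
  have hu : Continuous fun x => Real.exp (2 * B x z) := by fun_prop
  have hf' := hf.mul_continuous hu fun x => (Real.exp_pos _).le
  refine le_trans (mul_le_mul_of_nonneg_right ?_ (integral_nonneg hg.nonneg)) (hz _ hf' ?_)
  · have : CompleteSpace E := FiniteDimensional.complete ℝ E
    have h0 : ∫ x, f x • B x z ∂μ = 0 := by
      have := (LinearMap.toContinuousLinearMap (B z)).integral_comp_comm
        (hf.integrable_smul μ continuous_id)
      simp only [LinearMap.coe_toContinuousLinearMap', map_smul, id, hf0, map_zero] at this
      simpa only [hB _ z] using this
    have h_int := hf.integrable_smul μ hBz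
    calc ∫ x, f x ∂μ = ∫ x, (f x + 2 * (f x • B x z)) ∂μ := by
          rw [integral_add (hf.integrable μ) (h_int.const_mul 2), integral_const_mul, h0]
          simp
      _ ≤ _ := by
          refine integral_mono ((hf.integrable μ).add (h_int.const_mul 2)) (hf'.integrable μ)
            fun x => ?_
          have := mul_le_mul_of_nonneg_left (Real.add_one_le_exp (2 * B x z)) (hf.nonneg x)
          simp only [smul_eq_mul]
          linarith
  · intro x y
    calc f x * Real.exp (2 * B x z) * g y = f x * g y * Real.exp (2 * B x z) := by ring
      _ ≤ Real.exp (-2 * B x y) * Real.exp (2 * B x z) :=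
        mul_le_mul_of_nonneg_right (hfg x y) (Real.exp_pos _).le
      _ = _ := by
        rw [← Real.exp_add, map_sub]; ring_nf

theorem ofReal_setIntegral_Ioi {f : ℝ → ℝ} (hf : IsTestDensity f) :
    ENNReal.ofReal (∫ s in Ioi (0 : ℝ), f s) = ∫⁻ s in Ioi (0 : ℝ), ENNReal.ofReal (f s) :=
  ofReal_integral_eq_lintegral_ofReal (hf.integrable volume).integrableOn
    (ae_of_all _ hf.nonneg)

theorem setIntegral_Ioi_mul_le_of_mul_le_exp {f g : ℝ → ℝ} (hf : IsTestDensity f)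
    (hg : IsTestDensity g) {b : ℝ}
    (hfg : ∀ s t, f s * g t ≤ Real.exp (-2 * (s * t + b))) :
    (∫ s in Ioi (0 : ℝ), f s) * ∫ s in Ioi (0 : ℝ), g s ≤ Real.pi / 4 * Real.exp (-2 * b) := by
  obtain ⟨M, hM⟩ := (hf.mul_continuous continuous_abs abs_nonneg).bdd
  obtain ⟨N, hN⟩ := (hg.mul_continuous continuous_abs abs_nonneg).bdd
  have hh : Measurable fun s : ℝ => Real.exp (-b) * Real.exp (-1 * s ^ 2) := by fun_prop
  have key := prekopa_leindler_Ioi hf.measurable hg.measurable hh hf.nonneg hg.nonneg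
    (fun s => by positivity) (M := M) (N := N)
    (fun s hs => by simpa [abs_of_pos hs, mul_comm] using hM s)
    (fun s hs => by simpa [abs_of_pos hs, mul_comm] using hN s)
    (fun s hs t ht => by
      refine (hfg s t).trans_eq ?_
      rw [Real.sq_sqrt (mul_pos hs ht).le, ← Real.exp_add, ← Real.exp_nat_mul]
      congr 1
      push_cast
      ring)
  have hgauss : Integrable (fun s : ℝ => Real.exp (-b) * Real.exp (-1 * s ^ 2)) :=
    (integrable_exp_neg_mul_sq one_pos).const_mul _
  rw [← ofReal_setIntegral_Ioi hf, ← ofReal_setIntegral_Ioi hg,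
    ← ofReal_integral_eq_lintegral_ofReal hgauss.integrableOn
      (ae_of_all _ fun s => by positivity), integral_const_mul, integral_gaussian_Ioi,
    ← ENNReal.ofReal_mul (integral_nonneg hf.nonneg), ← ENNReal.ofReal_pow (by positivity),
    ENNReal.ofReal_le_ofReal_iff (by positivity)] at key
  refine key.trans_eq ?_
  rw [div_one, mul_pow, div_pow, Real.sq_sqrt Real.pi_pos.le, ← Real.exp_nat_mul]
  push_cast
  ring_nf

/-- One half of the inductive step: fiberwise integration over a half-line. -/
theorem CenteredSantalo.integral_half_mul_le {μ : Measure E} {B : LinearMap.BilinForm ℝ E} {C : ℝ}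
    (h : CenteredSantalo μ B C) (hB : ∀ x y, B x y = B y x) {f g : ℝ × E → ℝ}
    (hf : IsTestDensity f) (hg : IsTestDensity g)
    (hg0 : ∫ y, (∫ s in Ioi (0 : ℝ), g (s, y)) • y ∂μ = 0)
    (hfg : ∀ s t x y, f (s, x) * g (t, y) ≤ Real.exp (-2 * (s * t + B x y))) :
    (∫ x, (∫ s in Ioi (0 : ℝ), f (s, x)) ∂μ) * (∫ y, (∫ s in Ioi (0 : ℝ), g (s, y)) ∂μ)
      ≤ Real.pi / 4 * C := by
  have hpi := Real.pi_pos
  have key := h (fun y => 4 / Real.pi * ∫ s in Ioi (0 : ℝ), g (s, y))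
    (fun x => ∫ s in Ioi (0 : ℝ), f (s, x))
    ((hg.setIntegral _).const_mul (by positivity)) (hf.setIntegral _)
    (by simp_rw [mul_smul]; rw [integral_smul, hg0, smul_zero])
    (fun y x => by
      have := setIntegral_Ioi_mul_le_of_mul_le_exp (hf.slice x) (hg.slice y) (b := B x y)
        (fun s t => hfg s t x y)
      rw [hB y x]
      calc _ = 4 / Real.pi * ((∫ s in Ioi (0 : ℝ), f (s, x)) * ∫ s in Ioi (0 : ℝ), g (s, y)) := by
            ring
        _ ≤ 4 / Real.pi * (Real.pi / 4 * Real.exp (-2 * B x y)) := by gcongr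
        _ = _ := by field_simp)
  rw [integral_const_mul] at key
  calc _ = Real.pi / 4 * (4 / Real.pi * (∫ y, (∫ s in Ioi (0 : ℝ), g (s, y)) ∂μ)
            * ∫ x, (∫ s in Ioi (0 : ℝ), f (s, x)) ∂μ) := by field_simp
    _ ≤ _ := by gcongr

end

theorem exists_integral_Ioi_eq_half {G : ℝ → ℝ} (hG : Integrable G) {R : ℝ}
    (hR : ∀ s, R < |s| → G s = 0) :
    ∃ m, ∫ s in Ioi m, G s = (∫ s, G s) / 2 ∧ ∫ s in Iic m, G s = (∫ s, G s) / 2 := by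
  set T := ∫ s, G s
  have hcont : Continuous fun m => ∫ s in (-|R| - 1)..m, G s :=
    intervalIntegral.continuous_primitive (fun a b => hG.intervalIntegrable) _
  have habs := le_abs_self R
  have hIic : ∀ m, ∫ s in Iic m, G s = ∫ s in (-|R| - 1)..m, G s := by
    intro m
    rw [← intervalIntegral.integral_Iic_sub_Iic hG.integrableOn hG.integrableOn]
    have : ∫ s in Iic (-|R| - 1), G s = 0 := by
      refine setIntegral_eq_zero_of_forall_eq_zero fun s hs => hR s ?_
      have := neg_le_abs s
      simp only [mem_Iic] at hs
      linarith
    rw [this, sub_zero]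
  have hT : ∫ s in (-|R| - 1)..(|R| + 1), G s = T := by
    rw [← hIic]
    refine setIntegral_eq_integral_of_forall_compl_eq_zero fun s hs => hR s ?_
    have := le_abs_self s
    simp only [mem_Iic, not_le] at hs
    linarith
  have hmem : T / 2 ∈ uIcc (∫ s in (-|R| - 1)..(-|R| - 1), G s)
      (∫ s in (-|R| - 1)..(|R| + 1), G s) := by
    rw [hT, intervalIntegral.integral_same]
    rcases le_total 0 T with h | h
    · rw [uIcc_of_le h]; constructor <;> linarith
    · rw [uIcc_of_ge h]; constructor <;> linarith
  obtain ⟨m, -, hm⟩ := intermediate_value_uIcc hcont.continuousOn hmem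
  have h1 : ∫ s in Iic m, G s = T / 2 := (hIic m).trans hm
  have h2 := intervalIntegral.integral_Iic_add_Ioi (b := m) hG.integrableOn hG.integrableOn
  exact ⟨m, by linarith, h1⟩

theorem setIntegral_Ioi_comp_add {V : Type*} [NormedAddCommGroup V] [NormedSpace ℝ V]
    (Φ : ℝ → V) (m : ℝ) : ∫ s in Ioi 0, Φ (s + m) = ∫ s in Ioi m, Φ s := by
  have := (measurePreserving_add_right volume m).setIntegral_preimage_emb
    (measurableEmbedding_addRight m) Φ (Ioi m)
  simpa using this

theorem setIntegral_Ioi_comp_neg_add {V : Type*} [NormedAddCommGroup V] [NormedSpace ℝ V]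
    (Φ : ℝ → V) (m : ℝ) : ∫ s in Ioi 0, Φ (-s + m) = ∫ s in Iic m, Φ s := by
  have := (measurePreserving_add_right volume m).setIntegral_preimage_emb
    (measurableEmbedding_addRight m) Φ (Iic m)
  rw [integral_comp_neg_Ioi (f := fun s => Φ (s + m)), neg_zero]
  simpa using this

section

set_option linter.unusedSectionVars false

variable {E : Type*} [NormedAddCommGroup E] [NormedSpace ℝ E] [FiniteDimensional ℝ E]
  [MeasurableSpace E] [BorelSpace E] {V : Type*} [NormedAddCommGroup V] [NormedSpace ℝ V]
  [FiniteDimensional ℝ V]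

theorem IsTestDensity.integral_setIntegral_smul {h : ℝ × E → ℝ} (hh : IsTestDensity h)
    (μ : Measure E) [IsFiniteMeasureOnCompacts μ] [SFinite μ] {u : E → V}
    (hu : Continuous u) (S : Set ℝ) :
    ∫ y, (∫ s in S, h (s, y)) • u y ∂μ = ∫ s in S, (∫ y, h (s, y) • u y ∂μ) := by
  have : CompleteSpace V := FiniteDimensional.complete ℝ V
  simp_rw [← integral_smul_const]
  have h_int := hh.integrable_smul (volume.prod μ) (hu.comp continuous_snd)
  rw [integral_integral_swap]
  have h2 : Integrable (fun p : ℝ × E => h p • u p.2) ((volume.restrict S).prod μ) :=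
    h_int.mono_measure (Measure.prod_mono Measure.restrict_le_self le_rfl)
  exact h2.swap

theorem IsTestDensity.integrable_integral_smul {h : ℝ × E → ℝ} (hh : IsTestDensity h)
    (μ : Measure E) [IsFiniteMeasureOnCompacts μ] [SFinite μ] {u : ℝ × E → V} (hu : Continuous u) :
    Integrable fun s => ∫ y, h (s, y) • u (s, y) ∂μ :=
  (hh.integrable_smul (volume.prod μ) hu).integral_prod_left

/-- The inductive step in the functional Santaló inequality: adding one dimension. -/
theorem CenteredSantalo.translatedSantalo_prod {μ : Measure E} [μ.IsAddHaarMeasure]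
    {B : LinearMap.BilinForm ℝ E} {C : ℝ} (h : CenteredSantalo μ B C)
    (hB : ∀ x y, B x y = B y x) {B' : LinearMap.BilinForm ℝ (ℝ × E)}
    (hB' : ∀ p q, B' p q = p.1 * q.1 + B p.2 q.2) :
    TranslatedSantalo (volume.prod μ) B' (Real.pi * C) := by
  intro g hg
  have hC : 0 ≤ C := by
    have h0 : IsTestDensity (fun _ : E => (0 : ℝ)) :=
      ⟨measurable_const, fun _ => le_rfl, ⟨0, fun _ => le_rfl⟩, 0, fun _ _ => rfl⟩
    simpa using h _ _ h0 h0 (by simp) (fun x y => by simpa using (Real.exp_pos _).le)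
  set T := ∫ p, g p ∂(volume.prod μ) with hT
  have hT0 : 0 ≤ T := integral_nonneg hg.nonneg
  rcases hT0.eq_or_lt with hTz | hTpos
  · refine ⟨0, fun f _ _ => ?_⟩
    rw [← hTz, mul_zero]
    exact mul_nonneg Real.pi_pos.le hC
  set G : ℝ → ℝ := fun s => ∫ y, g (s, y) ∂μ with hGdef
  set G₁ : ℝ → E := fun s => ∫ y, g (s, y) • y ∂μ with hG₁def
  have hGint : Integrable G := (hg.integrable _).integral_prod_left
  have hG₁int : Integrable G₁ := hg.integrable_integral_smul μ continuous_snd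
  have hG0 : ∀ s, 0 ≤ G s := fun s => integral_nonneg fun y => hg.nonneg _
  have hGT : ∫ s, G s = T := (integral_prod _ (hg.integrable _)).symm
  obtain ⟨R, hR⟩ := hg.supp
  obtain ⟨m, hm₁, hm₂⟩ := exists_integral_Ioi_eq_half hGint (R := R) fun s hs => by
    have : ∀ y, g (s, y) = 0 := fun y => hR _ (lt_of_lt_of_le hs (le_max_left _ _))
    simp [hGdef, this]
  rw [hGT] at hm₁ hm₂
  have hDint : Integrable fun s => (s - m) * G s := by
    have := hg.integrable_integral_smul μ (u := fun p => p.1 - m) (by fun_prop)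
    simp only [smul_eq_mul, integral_mul_const] at this
    simpa [hGdef, mul_comm] using this
  set dp := ∫ s in Ioi m, (s - m) * G s with hdp
  set dm := ∫ s in Iic m, (s - m) * G s with hdm
  have hdp0 : 0 < dp := by
    have hnn : 0 ≤ᵐ[volume.restrict (Ioi m)] fun s => (s - m) * G s :=
      (ae_restrict_iff' measurableSet_Ioi).2 (ae_of_all _ fun s hs =>
        mul_nonneg (sub_nonneg.2 (le_of_lt hs)) (hG0 s))
    refine lt_of_le_of_ne (integral_nonneg_of_ae hnn) fun h0 => ?_
    have hz := (integral_eq_zero_iff_of_nonneg_ae hnn hDint.integrableOn).1 h0.symm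
    have : ∫ s in Ioi m, G s = 0 := by
      refine integral_eq_zero_of_ae ?_
      filter_upwards [hz, ae_restrict_mem measurableSet_Ioi] with s hs hs'
      exact (mul_eq_zero.1 hs).resolve_left (sub_pos.2 hs').ne'
    linarith
  have hdm0 : dm ≤ 0 := setIntegral_nonpos measurableSet_Iic fun s hs =>
    mul_nonpos_of_nonpos_of_nonneg (sub_nonpos.2 hs) (hG0 s)
  set ep := ∫ s in Ioi m, G₁ s
  set em := ∫ s in Iic m, G₁ s
  set w : E := (dp - dm)⁻¹ • (ep - em) with hw
  set ζ : E := (T / 2)⁻¹ • (ep - dp • w) with hζ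
  have hζ' : (T / 2) • ζ = ep - dp • w := by
    rw [hζ, smul_inv_smul₀ (by positivity)]
  have hw' : (dp - dm) • w = ep - em := by
    rw [hw, smul_inv_smul₀ (by linarith)]
  have hCE : CompleteSpace E := FiniteDimensional.complete ℝ E
  have hinner : ∀ s, ∫ y, g (s, y) • (y - (ζ + (s - m) • w)) ∂μ
      = G₁ s - (G s • ζ + ((s - m) * G s) • w) := by
    intro s
    have hgs := hg.slice_left s
    simp_rw [smul_sub]
    rw [integral_sub (hgs.integrable_smul μ continuous_id')
      (hgs.integrable_smul μ continuous_const), integral_smul_const, smul_add,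
      mul_comm (s - m), mul_smul (G s) (s - m) w]
  have hcenter : ∀ S, ∫ s in S, (∫ y, g (s, y) • (y - (ζ + (s - m) • w)) ∂μ)
      = (∫ s in S, G₁ s) - ((∫ s in S, G s) • ζ + (∫ s in S, (s - m) * G s) • w) := by
    intro S
    simp_rw [hinner]
    rw [integral_sub hG₁int.integrableOn, integral_add, integral_smul_const, integral_smul_const]
    · exact (hGint.smul_const ζ).integrableOn
    · exact (hDint.smul_const w).integrableOn
    · exact ((hGint.smul_const ζ).add (hDint.smul_const w)).integrableOn
  refine ⟨(m, ζ), fun f hf hfg => ?_⟩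
  have hBw : Continuous fun x => B x w := by
    simpa only [hB _ w] using (B w).continuous_of_finiteDimensional
  have hg' : IsTestDensity fun p : ℝ × E => g (p.1 + m, p.2 + (ζ + p.1 • w)) :=
    hg.comp (φ := fun p : ℝ × E => (p.1 + m, p.2 + (ζ + p.1 • w)))
      (ψ := fun p : ℝ × E => (p.1 - m, p.2 - (ζ + (p.1 - m) • w))) (by fun_prop) (by fun_prop)
      (fun p => by ext <;> simp)
  have hf' : IsTestDensity fun p : ℝ × E => f (p.1 - B p.2 w, p.2) :=
    hf.comp (φ := fun p : ℝ × E => (p.1 - B p.2 w, p.2))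
      (ψ := fun p : ℝ × E => (p.1 + B p.2 w, p.2)) (by fun_prop) (by fun_prop)
      (fun p => by ext <;> simp)
  have hg'' : IsTestDensity fun p : ℝ × E => g (-p.1 + m, p.2 + (ζ + -p.1 • w)) :=
    hg'.comp (φ := fun p : ℝ × E => (-p.1, p.2)) (ψ := fun p : ℝ × E => (-p.1, p.2))
      (by fun_prop) (by fun_prop) (fun p => by ext <;> simp)
  have hf'' : IsTestDensity fun p : ℝ × E => f (-p.1 - B p.2 w, p.2) :=
    hf'.comp (φ := fun p : ℝ × E => (-p.1, p.2)) (ψ := fun p : ℝ × E => (-p.1, p.2))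
      (by fun_prop) (by fun_prop) (fun p => by ext <;> simp)
  have hfg' : ∀ s t x y, f (s - B x w, x) * g (t + m, y + (ζ + t • w))
      ≤ Real.exp (-2 * (s * t + B x y)) := by
    intro s t x y
    refine (hfg _ _).trans_eq ?_
    rw [hB']
    simp only [Prod.mk_sub_mk]
    rw [show y + (ζ + t • w) - ζ = y + t • w by abel, map_add, (B x).map_smul t w]
    simp only [smul_eq_mul]
    ring_nf
  have shift : ∀ s, ∫ y, g (s + m, y + (ζ + s • w)) • y ∂μ
      = ∫ y, g (s + m, y) • (y - (ζ + (s + m - m) • w)) ∂μ := by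
    intro s
    rw [← integral_add_right_eq_self (fun y => g (s + m, y) • (y - (ζ + (s + m - m) • w)))
      (ζ + s • w)]
    simp
  have shift' : ∀ s, ∫ y, g (s + m, y + (ζ + s • w)) ∂μ = G (s + m) := fun s =>
    integral_add_right_eq_self (fun y => g (s + m, y)) (ζ + s • w)
  have half₁ := h.integral_half_mul_le hB hf' hg' (by
      rw [hg'.integral_setIntegral_smul μ continuous_id']
      simp only [shift]
      rw [setIntegral_Ioi_comp_add (fun s => ∫ y, g (s, y) • (y - (ζ + (s - m) • w)) ∂μ),
        hcenter, hm₁, hζ']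
      abel)
    (fun s t x y => hfg' s t x y)
  have half₂ := h.integral_half_mul_le hB hf'' hg'' (by
      rw [hg''.integral_setIntegral_smul μ continuous_id']
      simp only [shift]
      rw [setIntegral_Ioi_comp_neg_add (fun s => ∫ y, g (s, y) • (y - (ζ + (s - m) • w)) ∂μ),
        hcenter, hm₂, hζ']
      have : dm • w = dp • w - (ep - em) := by rw [← hw', sub_smul]; abel
      change em - (ep - dp • w + dm • w) = 0
      rw [this]
      abel)
    (fun s t x y => by simpa using hfg' (-s) (-t) x y)
  have swap : ∀ {k : ℝ × E → ℝ}, IsTestDensity k → ∀ S : Set ℝ,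
      ∫ y, (∫ s in S, k (s, y)) ∂μ = ∫ s in S, (∫ y, k (s, y) ∂μ) := fun hk S => by
    simpa using hk.integral_setIntegral_smul μ (continuous_const (y := (1 : ℝ))) S
  rw [swap hg'] at half₁
  rw [swap hg''] at half₂
  simp only [shift'] at half₁ half₂
  rw [setIntegral_Ioi_comp_add G, hm₁] at half₁
  rw [setIntegral_Ioi_comp_neg_add G, hm₂] at half₂
  have htotal : (∫ x, (∫ s in Ioi (0 : ℝ), f (s - B x w, x)) ∂μ)
      + (∫ x, (∫ s in Ioi (0 : ℝ), f (-s - B x w, x)) ∂μ) = ∫ p, f p ∂(volume.prod μ) := by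
    rw [← integral_add ((hf'.setIntegral _).integrable μ) ((hf''.setIntegral _).integrable μ),
      integral_prod_symm _ (hf.integrable _)]
    congr 1 with x
    rw [← integral_sub_right_eq_self (fun s => f (s, x)) (B x w),
      ← intervalIntegral.integral_Iic_add_Ioi (b := 0)
        ((hf'.slice x).integrable volume).integrableOn
        ((hf'.slice x).integrable volume).integrableOn,
      integral_comp_neg_Ioi (f := fun s => f (s - B x w, x)), neg_zero, add_comm]
  rw [← htotal]
  linarith

end

theorem CenteredSantalo.map {E F : Type*} [NormedAddCommGroup E] [NormedSpace ℝ E]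
    [FiniteDimensional ℝ E] [MeasurableSpace E] [BorelSpace E] [NormedAddCommGroup F]
    [NormedSpace ℝ F] [FiniteDimensional ℝ F] [MeasurableSpace F] [BorelSpace F]
    {μ : Measure E} {ν : Measure F} [IsFiniteMeasureOnCompacts ν]
    {B : LinearMap.BilinForm ℝ E} {B' : LinearMap.BilinForm ℝ F}
    {C : ℝ} (h : CenteredSantalo μ B C) (e : E ≃L[ℝ] F) (he : MeasurePreserving e μ ν)
    (hB : ∀ x y, B' (e x) (e y) = B x y) : CenteredSantalo ν B' C := by
  intro f g hf hg hf0 hfg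
  have hcomp : ∀ {k : F → ℝ}, IsTestDensity k → IsTestDensity fun x => k (e x) := fun hk =>
    hk.comp e.continuous e.symm.continuous e.symm_apply_apply
  have hemb : MeasurableEmbedding e := e.toHomeomorph.measurableEmbedding
  have key := h _ _ (hcomp hf) (hcomp hg) ?_ fun x y => hB x y ▸ hfg (e x) (e y)
  · rwa [he.integral_comp hemb, he.integral_comp hemb] at key
  · have hE : CompleteSpace E := FiniteDimensional.complete ℝ E
    have hF : CompleteSpace F := FiniteDimensional.complete ℝ F
    have h1 := he.integral_comp hemb fun y => f y • e.symm y
    have h2 := (e.symm : F →L[ℝ] E).integral_comp_comm (hf.integrable_smul ν continuous_id')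
    rw [hf0, map_zero] at h2
    simp only [ContinuousLinearEquiv.coe_coe, map_smul] at h2
    rw [h2] at h1
    simpa using h1

theorem centeredSantalo_dotProduct (n : ℕ) :
    CenteredSantalo (volume : Measure (Fin n → ℝ)) (dotProductBilin ℝ ℝ) (Real.pi ^ n) := by
  induction n with
  | zero =>
    intro f g hf hg _ hfg
    have h := hfg 0 0
    have hvol : (volume : Measure (Fin 0 → ℝ)) = Measure.dirac 0 := by
      rw [volume_pi, Measure.pi_of_empty (fun _ => volume) 0]
    rw [hvol, integral_dirac, integral_dirac]
    simpa using h
  | succ n ih =>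
    let B' : LinearMap.BilinForm ℝ (ℝ × (Fin n → ℝ)) :=
      (LinearMap.mul ℝ ℝ).compl₁₂ (LinearMap.fst ℝ ℝ _) (LinearMap.fst ℝ ℝ _) +
        (dotProductBilin ℝ ℝ).compl₁₂ (LinearMap.snd ℝ ℝ _) (LinearMap.snd ℝ ℝ _)
    have hB' : ∀ p q, B' p q = p.1 * q.1 + dotProductBilin ℝ ℝ p.2 q.2 := fun _ _ => rfl
    have hsymm : ∀ x y : Fin n → ℝ, dotProductBilin ℝ ℝ x y = dotProductBilin ℝ ℝ y x :=
      dotProduct_comm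
    have key := (ih.translatedSantalo_prod hsymm hB').centered fun p q => by
      rw [hB', hB', hsymm, mul_comm]
    rw [pow_succ']
    refine key.map (Fin.consEquivL ℝ fun _ : Fin (n + 1) => ℝ) ?_ fun x y => ?_
    · have h : ⇑(Fin.consEquivL ℝ fun _ : Fin (n + 1) => ℝ)
          = (MeasurableEquiv.piFinSuccAbove (fun _ : Fin (n + 1) => ℝ) 0).symm :=
        funext fun p => (Fin.insertNth_zero (α := fun _ => ℝ) p.1 p.2).symm
      rw [h]
      exact (volume_preserving_piFinSuccAbove (fun _ : Fin (n + 1) => ℝ) 0).symm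
    · rw [hB']
      simp [Fin.consEquivL, dotProductBilin, dotProduct, Fin.sum_univ_succ]

theorem centeredSantalo_euclideanSpace (n : ℕ) :
    CenteredSantalo (volume : Measure (EuclideanSpace ℝ (Fin n))) (innerₗ _) (Real.pi ^ n) := by
  refine (centeredSantalo_dotProduct n).map (PiLp.continuousLinearEquiv 2 ℝ fun _ => ℝ).symm
    (PiLp.volume_preserving_toLp (Fin n)) fun x y => ?_
  simp [PiLp.inner_apply, dotProductBilin, dotProduct, mul_comm]

theorem integral_mul_integral_le_of_even {n : ℕ} {f g : EuclideanSpace ℝ (Fin n) → ℝ}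
    (hf : IsTestDensity f) (hg : IsTestDensity g) (hfe : ∀ x, f (-x) = f x)
    (hfg : ∀ x y, f x * g y ≤ Real.exp (-2 * ⟪x, y⟫)) :
    (∫ x, f x) * ∫ x, g x ≤ Real.pi ^ n := by
  refine centeredSantalo_euclideanSpace n f g hf hg ?_ hfg
  have h := integral_neg_eq_self (fun x => f x • x) volume
  simp only [hfe, smul_neg, integral_neg] at h
  have h2 : (2 : ℝ) • ∫ x, f x • x = 0 := by
    rw [two_smul]
    exact add_eq_zero_iff_eq_neg.2 h.symm
  exact (smul_eq_zero.1 h2).resolve_left two_ne_zero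

/-- A real-valued function which is a norm, in addition to being continuous. -/
structure IsContinuousNorm {E : Type*} [NormedAddCommGroup E] [NormedSpace ℝ E] (p : E → ℝ) :
    Prop where
  neg : ∀ x, p (-x) = p x
  add : ∀ x y, p (x + y) ≤ p x + p y
  eq_zero : ∀ {x}, p x = 0 → x = 0
  smul : ∀ (r : ℝ) (x : E), p (r • x) ≤ |r| * p x
  nonneg : ∀ x, 0 ≤ p x
  continuous : Continuous p

namespace IsContinuousNorm

variable {E : Type*} [NormedAddCommGroup E] [NormedSpace ℝ E]

theorem map_zero {p : E → ℝ} (hp : IsContinuousNorm p) : p 0 = 0 :=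
  le_antisymm (by simpa using hp.smul 0 0) (hp.nonneg 0)

theorem volume_le_one [FiniteDimensional ℝ E] [MeasurableSpace E] [BorelSpace E] [Nontrivial E]
    {p : E → ℝ} (hp : IsContinuousNorm p) (μ : Measure E) [μ.IsAddHaarMeasure] :
    μ {x | p x ≤ 1} = ENNReal.ofReal
      ((∫ x, Real.exp (-p x ^ (2 : ℝ)) ∂μ) / Real.Gamma (Module.finrank ℝ E / 2 + 1)) := by
  rw [measure_le_eq_lt μ hp.map_zero hp.neg hp.add hp.eq_zero hp.smul,
    measure_lt_one_eq_integral_div_gamma μ hp.map_zero hp.neg hp.add hp.eq_zero hp.smul two_pos]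

end IsContinuousNorm

section

variable {n : ℕ}

theorem integral_exp_neg_sq_mul_le_pi_pow {p q : EuclideanSpace ℝ (Fin n) → ℝ}
    (hp : IsContinuousNorm p) (hq : IsContinuousNorm q)
    (hpq : ∀ x y, |⟪x, y⟫| ≤ p x * q y) :
    (∫ x, Real.exp (-p x ^ (2 : ℝ))) * ∫ x, Real.exp (-q x ^ (2 : ℝ)) ≤ Real.pi ^ n := by
  by_cases hpi : Integrable fun x => Real.exp (-p x ^ (2 : ℝ))
  swap
  · rw [integral_undef hpi, zero_mul]; positivity
  by_cases hqi : Integrable fun x => Real.exp (-q x ^ (2 : ℝ))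
  swap
  · rw [integral_undef hqi, mul_zero]; positivity
  have hcov : AECover (volume : Measure (EuclideanSpace ℝ (Fin n))) atTop
      fun k : ℕ => Metric.closedBall 0 (k : ℝ) := aecover_closedBall tendsto_natCast_atTop_atTop
  refine le_of_tendsto ((hcov.integral_tendsto_of_countably_generated hpi).mul
    (hcov.integral_tendsto_of_countably_generated hqi)) (Eventually.of_forall fun k => ?_)
  rw [← integral_indicator Metric.isClosed_closedBall.measurableSet,
    ← integral_indicator Metric.isClosed_closedBall.measurableSet]
  have test : ∀ {p : EuclideanSpace ℝ (Fin n) → ℝ}, IsContinuousNorm p → IsTestDensity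
      ((Metric.closedBall 0 (k : ℝ)).indicator fun x => Real.exp (-p x ^ (2 : ℝ))) := by
    intro p hp
    refine ⟨Measurable.indicator ?_ Metric.isClosed_closedBall.measurableSet,
      fun x => indicator_nonneg (fun _ _ => (Real.exp_pos _).le) x, ⟨1, fun x => ?_⟩, k,
      fun x hx => indicator_of_notMem (by simpa using hx) _⟩
    · have := hp.continuous.measurable
      fun_prop
    · refine indicator_apply_le' (fun _ => ?_) fun _ => zero_le_one
      rw [Real.exp_le_one_iff, neg_nonpos]
      exact Real.rpow_nonneg (hp.nonneg x) _
  refine integral_mul_integral_le_of_even (test hp) (test hq) (fun x => ?_) fun x y => ?_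
  · simp only [indicator, mem_closedBall_zero_iff, norm_neg, hp.neg]
  · refine (mul_le_mul (indicator_le_self' (fun _ _ => (Real.exp_pos _).le) x)
      (indicator_le_self' (fun _ _ => (Real.exp_pos _).le) y) ((test hq).nonneg y)
      (Real.exp_pos _).le).trans ?_
    rw [← Real.exp_add, Real.exp_le_exp, Real.rpow_two, Real.rpow_two]
    have h1 := (le_abs_self _).trans (hpq x y)
    nlinarith [sq_nonneg (p x - q y)]

theorem volume_mul_volume_le_of_norms {p q : EuclideanSpace ℝ (Fin n) → ℝ} (hn : n ≠ 0)
    (hp : IsContinuousNorm p) (hq : IsContinuousNorm q)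
    (hpq : ∀ x y, |⟪x, y⟫| ≤ p x * q y) :
    volume {x | p x ≤ 1} * volume {x | q x ≤ 1}
      ≤ volume (Metric.ball (0 : EuclideanSpace ℝ (Fin n)) 1) ^ 2 := by
  have : NeZero n := ⟨hn⟩
  have hG : 0 < Real.Gamma ((n : ℝ) / 2 + 1) := Real.Gamma_pos_of_pos (by positivity)
  rw [hp.volume_le_one, hq.volume_le_one, EuclideanSpace.volume_ball, finrank_euclideanSpace,
    Fintype.card_fin, ENNReal.ofReal_one, one_pow, one_mul, ← ENNReal.ofReal_pow (by positivity),
    ← ENNReal.ofReal_mul (div_nonneg (integral_nonneg fun _ => (Real.exp_pos _).le) hG.le)]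
  refine ENNReal.ofReal_le_ofReal ?_
  rw [div_mul_div_comm, div_pow, ← pow_mul, mul_comm n, pow_mul, Real.sq_sqrt Real.pi_pos.le,
    sq (Real.Gamma _)]
  gcongr
  exact integral_exp_neg_sq_mul_le_pi_pow hp hq hpq

/-- The support function of the symmetric hull of a set. -/
noncomputable def absSupport (S : Set (EuclideanSpace ℝ (Fin n))) (x : EuclideanSpace ℝ (Fin n)) :
    ℝ := ⨆ y : S, |⟪x, (y : EuclideanSpace ℝ (Fin n))⟫|

theorem abs_inner_le_absSupport {S : Set (EuclideanSpace ℝ (Fin n))} {R : ℝ}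
    (hR : S ⊆ Metric.closedBall 0 R) (x : EuclideanSpace ℝ (Fin n)) {y} (hy : y ∈ S) :
    |⟪x, y⟫| ≤ absSupport S x := by
  refine le_ciSup (f := fun y : S => |⟪x, (y : EuclideanSpace ℝ (Fin n))⟫|)
    ⟨‖x‖ * R, ?_⟩ ⟨y, hy⟩
  rintro _ ⟨z, rfl⟩
  exact (abs_real_inner_le_norm x z).trans
    (mul_le_mul_of_nonneg_left (by simpa using hR z.2) (norm_nonneg x))

theorem absSupport_le {S : Set (EuclideanSpace ℝ (Fin n))} {x : EuclideanSpace ℝ (Fin n)} {a : ℝ}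
    (ha : 0 ≤ a) (h : ∀ y ∈ S, |⟪x, y⟫| ≤ a) : absSupport S x ≤ a :=
  Real.iSup_le (fun y => h y y.2) ha

theorem absSupport_nonneg (S : Set (EuclideanSpace ℝ (Fin n))) (x : EuclideanSpace ℝ (Fin n)) :
    0 ≤ absSupport S x :=
  Real.iSup_nonneg fun _ => abs_nonneg _

theorem mul_norm_le_absSupport {S : Set (EuclideanSpace ℝ (Fin n))} {R ε : ℝ} (hε : 0 ≤ ε)
    (hR : S ⊆ Metric.closedBall 0 R) (hS : Metric.closedBall 0 ε ⊆ S)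
    (x : EuclideanSpace ℝ (Fin n)) : ε * ‖x‖ ≤ absSupport S x := by
  rcases eq_or_ne x 0 with rfl | hx
  · simpa using absSupport_nonneg S 0
  have hx' : 0 < ‖x‖ := norm_pos_iff.2 hx
  have hmem : (ε * ‖x‖⁻¹) • x ∈ S := hS (by
    rw [mem_closedBall_zero_iff, norm_smul, Real.norm_of_nonneg (by positivity), mul_assoc,
      inv_mul_cancel₀ hx'.ne', mul_one])
  refine le_trans (le_of_eq ?_) (abs_inner_le_absSupport hR x hmem)
  rw [inner_smul_right, real_inner_self_eq_norm_sq, abs_of_nonneg (by positivity)]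
  field_simp

theorem absSupport_le_mul_norm {S : Set (EuclideanSpace ℝ (Fin n))} {R : ℝ} (hR0 : 0 ≤ R)
    (hR : S ⊆ Metric.closedBall 0 R) (x : EuclideanSpace ℝ (Fin n)) :
    absSupport S x ≤ R * ‖x‖ :=
  absSupport_le (by positivity) fun y hy => (abs_real_inner_le_norm x y).trans (by
    rw [mul_comm]
    exact mul_le_mul_of_nonneg_right (by simpa using hR hy) (norm_nonneg x))

theorem isContinuousNorm_absSupport {S : Set (EuclideanSpace ℝ (Fin n))} {R ε : ℝ} (hε : 0 < ε)
    (hR0 : 0 ≤ R) (hR : S ⊆ Metric.closedBall 0 R) (hS : Metric.closedBall 0 ε ⊆ S) :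
    IsContinuousNorm (absSupport S) := by
  have hadd : ∀ x y, absSupport S (x + y) ≤ absSupport S x + absSupport S y := fun x y =>
    absSupport_le (add_nonneg (absSupport_nonneg S x) (absSupport_nonneg S y)) fun z hz => by
      rw [inner_add_left]
      exact (abs_add_le _ _).trans
        (add_le_add (abs_inner_le_absSupport hR x hz) (abs_inner_le_absSupport hR y hz))
  refine ⟨fun x => by simp [absSupport], hadd, fun {x} hx => ?_, fun r x => ?_,
    absSupport_nonneg S, ?_⟩
  · have := mul_norm_le_absSupport hε.le hR hS x
    rw [hx] at this
    by_contra h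
    have := norm_pos_iff.2 h
    nlinarith
  · refine absSupport_le (mul_nonneg (abs_nonneg r) (absSupport_nonneg S x)) fun y hy => ?_
    rw [real_inner_smul_left, abs_mul]
    exact mul_le_mul_of_nonneg_left (abs_inner_le_absSupport hR x hy) (abs_nonneg r)
  · refine (LipschitzWith.of_le_add_mul ⟨R, hR0⟩ fun x y => ?_).continuous
    calc absSupport S x = absSupport S (y + (x - y)) := by rw [add_sub_cancel]
      _ ≤ absSupport S y + absSupport S (x - y) := hadd _ _
      _ ≤ absSupport S y + R * dist x y := by
        rw [dist_eq_norm]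
        gcongr
        exact absSupport_le_mul_norm hR0 hR _

theorem volume_mul_volume_le_of_abs_inner_le_one (hn : n ≠ 0)
    {K L : Set (EuclideanSpace ℝ (Fin n))} (hK : Bornology.IsBounded K)
    (hL : Bornology.IsBounded L) (h : ∀ x ∈ K, ∀ y ∈ L, |⟪x, y⟫| ≤ 1) :
    volume K * volume L ≤ volume (Metric.ball (0 : EuclideanSpace ℝ (Fin n)) 1) ^ 2 := by
  obtain ⟨R, hR1, hR⟩ : ∃ R, 1 ≤ R ∧ K ⊆ Metric.closedBall 0 R ∧ L ⊆ Metric.closedBall 0 R := by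
    obtain ⟨R, hR⟩ := (hK.union hL).subset_closedBall 0
    exact ⟨max 1 R, le_max_left _ _, (subset_union_left.trans hR).trans
      (Metric.closedBall_subset_closedBall (le_max_right _ _)), (subset_union_right.trans hR).trans
      (Metric.closedBall_subset_closedBall (le_max_right _ _))⟩
  have hR0 : 0 < R := by linarith
  have hRi : 0 < R⁻¹ := by positivity
  set L' := L ∪ Metric.closedBall 0 R⁻¹ with hL'
  have hL'R : L' ⊆ Metric.closedBall 0 R := union_subset hR.2
    (Metric.closedBall_subset_closedBall ((inv_le_one_of_one_le₀ hR1).trans hR1))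
  have hL'b : Metric.closedBall 0 R⁻¹ ⊆ L' := subset_union_right
  set p := absSupport L'
  have hp : IsContinuousNorm p := isContinuousNorm_absSupport hRi hR0.le hL'R hL'b
  set P := {x | p x ≤ 1}
  have hPR : P ⊆ Metric.closedBall 0 R := fun x hx => by
    have h1 := (mul_norm_le_absSupport hRi.le hL'R hL'b x).trans hx
    rw [mem_closedBall_zero_iff]
    rwa [inv_mul_le_iff₀ hR0, mul_one] at h1
  have hPb : Metric.closedBall 0 R⁻¹ ⊆ P := fun x hx => by
    rw [mem_closedBall_zero_iff] at hx
    refine (absSupport_le_mul_norm hR0.le hL'R x).trans ?_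
    calc R * ‖x‖ ≤ R * R⁻¹ := by gcongr
      _ = 1 := mul_inv_cancel₀ hR0.ne'
  have hq : IsContinuousNorm (absSupport P) := isContinuousNorm_absSupport hRi hR0.le hPR hPb
  have hKP : K ⊆ P := fun x hx => absSupport_le zero_le_one fun y hy => by
    rcases hy with hy | hy
    · exact h x hx y hy
    · have hx' := hR.1 hx
      rw [mem_closedBall_zero_iff] at hx' hy
      calc |⟪x, y⟫| ≤ ‖x‖ * ‖y‖ := abs_real_inner_le_norm x y
        _ ≤ R * R⁻¹ := by gcongr
        _ = 1 := mul_inv_cancel₀ hR0.ne'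
  have hLQ : L ⊆ {y | absSupport P y ≤ 1} := fun y hy => absSupport_le zero_le_one fun x hx => by
    rw [real_inner_comm]
    exact (abs_inner_le_absSupport hL'R x (Or.inl hy)).trans hx
  refine (mul_le_mul' (measure_mono hKP) (measure_mono hLQ)).trans
    (volume_mul_volume_le_of_norms hn hp hq fun x y => ?_)
  rcases (hp.nonneg x).eq_or_lt with h0 | h0
  · rw [hp.eq_zero h0.symm]
    simpa using mul_nonneg (hp.nonneg 0) (hq.nonneg y)
  · have hmem : (p x)⁻¹ • x ∈ P := (hp.smul _ x).trans_eq (by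
      rw [abs_of_pos (inv_pos.2 h0), inv_mul_cancel₀ h0.ne'])
    have := abs_inner_le_absSupport hPR y hmem
    rw [inner_smul_right, abs_mul, abs_of_pos (inv_pos.2 h0), inv_mul_le_iff₀ h0,
      real_inner_comm] at this
    exact this

open scoped Pointwise in
/-- Symmetric Santaló inequality. -/
theorem volume_mul_volume_le_of_abs_inner_le {K L : Set (EuclideanSpace ℝ (Fin n))} {r : ℝ}
    (hr : 0 ≤ r) (hK : Bornology.IsBounded K) (hL : Bornology.IsBounded L)
    (h : ∀ x ∈ K, ∀ y ∈ L, |⟪x, y⟫| ≤ r) :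
    volume K * volume L ≤ volume (Metric.closedBall (0 : EuclideanSpace ℝ (Fin n)) √r) ^ 2 := by
  rcases eq_or_ne n 0 with rfl | hn
  · have huniv : Metric.closedBall (0 : EuclideanSpace ℝ (Fin 0)) √r = univ :=
      eq_univ_of_forall fun x => by simp [Subsingleton.elim x 0]
    rw [huniv, sq]
    exact mul_le_mul' (measure_mono (subset_univ _)) (measure_mono (subset_univ _))
  set c := volume (Metric.ball (0 : EuclideanSpace ℝ (Fin n)) 1) with hc
  rw [Measure.addHaar_closedBall _ _ (Real.sqrt_nonneg r), finrank_euclideanSpace,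
    Fintype.card_fin, mul_pow, ← ENNReal.ofReal_pow (by positivity), ← pow_mul, mul_comm n,
    pow_mul, Real.sq_sqrt hr]
  have hcont : Continuous fun r : ℝ => ENNReal.ofReal (r ^ n) * c ^ 2 := by
    refine ENNReal.continuous_mul_const (ENNReal.pow_ne_top measure_ball_lt_top.ne) |>.comp
      (ENNReal.continuous_ofReal.comp (continuous_pow n))
  refine ge_of_tendsto ((hcont.tendsto r).mono_left (nhdsWithin_le_nhds (s := Ioi r))) ?_
  filter_upwards [self_mem_nhdsWithin] with s hs
  have hs0 : 0 < s := hr.trans_lt hs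
  have key := volume_mul_volume_le_of_abs_inner_le_one hn (hK.smul₀ s⁻¹) hL (by
    rintro _ ⟨x, hx, rfl⟩ y hy
    simp only [real_inner_smul_left, abs_mul, abs_of_pos (inv_pos.2 hs0)]
    rw [inv_mul_le_iff₀ hs0, mul_one]
    exact (h x hx y hy).trans (le_of_lt hs))
  have hscale : volume K = ENNReal.ofReal (s ^ n) * volume (s⁻¹ • K) := by
    rw [Measure.addHaar_smul, finrank_euclideanSpace, Fintype.card_fin, ← mul_assoc,
      ← ENNReal.ofReal_mul (by positivity), abs_of_pos (by positivity), inv_pow,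
      mul_inv_cancel₀ (by positivity), ENNReal.ofReal_one, one_mul]
  rw [hscale, mul_assoc]
  exact mul_le_mul_right key _

end

section

variable {n : ℕ} {ρ : ℝ → ℝ} {f g : EuclideanSpace ℝ (Fin n) → ℝ}

theorem IsTestDensity.isBounded_superlevel (hf : IsTestDensity f) {s : ℝ} (hs : 0 ≤ s) :
    Bornology.IsBounded {x | s < f x} := by
  obtain ⟨R, hR⟩ := hf.supp
  refine Metric.isBounded_closedBall.subset (t := Metric.closedBall 0 R) fun x hx => ?_
  rw [mem_closedBall_zero_iff]
  by_contra! h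
  have : s < f x := hx
  rw [hR x h] at this
  linarith

theorem volume_superlevel_mul_le (hcont : ContinuousOn ρ (Ici 0)) (hanti : AntitoneOn ρ (Ici 0))
    (hpos : ∀ t, 0 ≤ t → 0 < ρ t)
    (hf : IsTestDensity f) (hg : IsTestDensity g)
    (hfg : ∀ x y, f x * g y ≤ ρ |⟪x, y⟫| ^ 2) {s t : ℝ} (hs : 0 < s) (ht : 0 < t) :
    volume {x | s < f x} * volume {x | t < g x}
      ≤ volume {x : EuclideanSpace ℝ (Fin n) | √(s * t) ≤ ρ (‖x‖ ^ 2)} ^ 2 := by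
  rcases eq_empty_or_nonempty {x | s < f x} with h | ⟨x₀, hx₀⟩
  · simp [h]
  rcases eq_empty_or_nonempty {x | t < g x} with h | ⟨y₀, hy₀⟩
  · simp [h]
  have hK := hf.isBounded_superlevel hs.le
  have hL := hg.isBounded_superlevel ht.le
  set u := √(s * t)
  set A : Set ℝ := (fun p : EuclideanSpace ℝ (Fin n) × EuclideanSpace ℝ (Fin n) => |⟪p.1, p.2⟫|) ''
    ({x | s < f x} ×ˢ {x | t < g x}) with hA
  have hAne : A.Nonempty := ⟨_, ⟨(x₀, y₀), ⟨hx₀, hy₀⟩, rfl⟩⟩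
  have hAb : BddAbove A := by
    obtain ⟨R, hR⟩ := (hK.union hL).subset_closedBall 0
    refine ⟨R * R, ?_⟩
    rintro _ ⟨⟨x, y⟩, ⟨hx, hy⟩, rfl⟩
    have h1 := hR (Or.inl hx)
    have h2 := hR (Or.inr hy)
    rw [mem_closedBall_zero_iff] at h1 h2
    exact (abs_real_inner_le_norm x y).trans
      (mul_le_mul h1 h2 (norm_nonneg _) ((norm_nonneg _).trans h1))
  have hclosed : IsClosed (Ici 0 ∩ ρ ⁻¹' Ici u) :=
    hcont.preimage_isClosed_of_isClosed isClosed_Ici isClosed_Ici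
  have hsub : A ⊆ Ici 0 ∩ ρ ⁻¹' Ici u := by
    rintro _ ⟨⟨x, y⟩, ⟨hx, hy⟩, rfl⟩
    have hx : s < f x := hx
    have hy : t < g y := hy
    refine ⟨mem_Ici.2 (abs_nonneg _), Real.sqrt_le_iff.2 ⟨(hpos _ (abs_nonneg _)).le, ?_⟩⟩
    exact (mul_le_mul hx.le hy.le ht.le (hf.nonneg x)).trans (hfg x y)
  obtain ⟨hr0, hr⟩ := closure_minimal hsub hclosed (csSup_mem_closure hAne hAb)
  refine (volume_mul_volume_le_of_abs_inner_le hr0 hK hL fun x hx y hy =>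
    le_csSup hAb ⟨(x, y), ⟨hx, hy⟩, rfl⟩).trans ?_
  gcongr
  intro x hx
  rw [mem_closedBall_zero_iff] at hx
  have hx2 : ‖x‖ ^ 2 ≤ sSup A := by
    rw [← Real.sq_sqrt hr0]
    gcongr
  exact (mem_preimage.1 hr).trans (hanti (mem_Ici.2 (sq_nonneg _)) hr0 hx2)

theorem lintegral_mul_lintegral_le_of_isTestDensity (hcont : ContinuousOn ρ (Ici 0))
    (hanti : AntitoneOn ρ (Ici 0)) (hpos : ∀ t, 0 ≤ t → 0 < ρ t)
    (h_int : Integrable fun x : EuclideanSpace ℝ (Fin n) => ρ (‖x‖ ^ 2))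
    (hf : IsTestDensity f) (hg : IsTestDensity g)
    (hfg : ∀ x y, f x * g y ≤ ρ |⟪x, y⟫| ^ 2) :
    (∫⁻ x, ENNReal.ofReal (f x)) * ∫⁻ x, ENNReal.ofReal (g x)
      ≤ (∫⁻ x : EuclideanSpace ℝ (Fin n), ENNReal.ofReal (ρ (‖x‖ ^ 2))) ^ 2 := by
  have layer : ∀ {k : EuclideanSpace ℝ (Fin n) → ℝ}, IsTestDensity k →
      Measurable (fun s => (volume {x | s < k x}).toReal) ∧
      (∃ M, ∀ s > 0, s * (volume {x | s < k x}).toReal ≤ M) ∧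
      ∫⁻ x, ENNReal.ofReal (k x) =
        ∫⁻ s in Ioi (0 : ℝ), ENNReal.ofReal (volume {x | s < k x}).toReal := by
    intro k hk
    refine ⟨?_, ?_, ?_⟩
    · have : Antitone fun s => volume {x | s < k x} := fun s t hst =>
        measure_mono fun x hx => lt_of_le_of_lt hst hx
      exact this.measurable.ennreal_toReal
    · obtain ⟨M, hM⟩ := hk.bdd
      have hM0 : 0 ≤ M := (hk.nonneg 0).trans (hM 0)
      refine ⟨M * (volume {x | 0 < k x}).toReal, fun s hs => ?_⟩
      rcases le_or_gt s M with h | h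
      · refine mul_le_mul h (ENNReal.toReal_mono (hk.isBounded_superlevel le_rfl).measure_lt_top.ne
          (measure_mono fun x hx => lt_trans hs hx)) ENNReal.toReal_nonneg hM0
      · have : {x | s < k x} = ∅ := eq_empty_of_forall_notMem fun x hx =>
          absurd (lt_of_lt_of_le hx (hM x)) h.not_gt
        simp only [this, measure_empty, ENNReal.toReal_zero, mul_zero]
        positivity
    · rw [lintegral_eq_lintegral_meas_lt volume (ae_of_all _ hk.nonneg) hk.measurable.aemeasurable]
      refine setLIntegral_congr_fun measurableSet_Ioi fun s hs => ?_
      exact (ENNReal.ofReal_toReal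
        (hk.isBounded_superlevel (le_of_lt hs)).measure_lt_top.ne).symm
  obtain ⟨hfm, ⟨M, hM⟩, hfe⟩ := layer hf
  obtain ⟨hgm, ⟨N, hN⟩, hge⟩ := layer hg
  have hρfin : ∀ s > 0, volume {x : EuclideanSpace ℝ (Fin n) | s ≤ ρ (‖x‖ ^ 2)} ≠ ⊤ :=
    fun s hs => (h_int.measure_ge_lt_top hs).ne
  have hρm : Measurable fun s =>
      (volume {x : EuclideanSpace ℝ (Fin n) | s ≤ ρ (‖x‖ ^ 2)}).toReal := by
    have : Antitone fun s => volume {x : EuclideanSpace ℝ (Fin n) | s ≤ ρ (‖x‖ ^ 2)} :=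
      fun s t hst => measure_mono fun x hx => le_trans hst hx
    exact this.measurable.ennreal_toReal
  have hρe : ∫⁻ x : EuclideanSpace ℝ (Fin n), ENNReal.ofReal (ρ (‖x‖ ^ 2)) =
      ∫⁻ s in Ioi (0 : ℝ),
        ENNReal.ofReal (volume {x : EuclideanSpace ℝ (Fin n) | s ≤ ρ (‖x‖ ^ 2)}).toReal := by
    rw [lintegral_eq_lintegral_meas_le volume
      (ae_of_all _ fun x => (hpos _ (sq_nonneg _)).le) h_int.aemeasurable]
    exact setLIntegral_congr_fun measurableSet_Ioi fun s hs =>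
      (ENNReal.ofReal_toReal (hρfin s hs)).symm
  rw [hfe, hge, hρe]
  refine prekopa_leindler_Ioi hfm hgm hρm (fun _ => ENNReal.toReal_nonneg)
    (fun _ => ENNReal.toReal_nonneg) (fun _ => ENNReal.toReal_nonneg) hM hN fun s hs t ht => ?_
  rw [← ENNReal.toReal_mul, ← ENNReal.toReal_pow]
  exact ENNReal.toReal_mono
    (ENNReal.pow_ne_top (hρfin _ (Real.sqrt_pos.2 (mul_pos hs ht))))
    (volume_superlevel_mul_le hcont hanti hpos hf hg hfg hs ht)

/-- Functional Santaló inequality for rotationally invariant weights. -/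
theorem lintegral_mul_lintegral_le (hcont : ContinuousOn ρ (Ici 0))
    (hanti : AntitoneOn ρ (Ici 0)) (hpos : ∀ t, 0 ≤ t → 0 < ρ t)
    (h_int : Integrable fun x : EuclideanSpace ℝ (Fin n) => ρ (‖x‖ ^ 2))
    (hfm : Measurable f) (hgm : Measurable g) (hf0 : ∀ x, 0 ≤ f x) (hg0 : ∀ x, 0 ≤ g x)
    (hfg : ∀ x y, f x * g y ≤ ρ |⟪x, y⟫| ^ 2) :
    (∫⁻ x, ENNReal.ofReal (f x)) * ∫⁻ x, ENNReal.ofReal (g x)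
      ≤ (∫⁻ x : EuclideanSpace ℝ (Fin n), ENNReal.ofReal (ρ (‖x‖ ^ 2))) ^ 2 := by
  let S : (EuclideanSpace ℝ (Fin n) → ℝ) → ℕ → Set (EuclideanSpace ℝ (Fin n)) := fun k i =>
    {x | ‖x‖ ≤ i ∧ k x ≤ i}
  have hSm : ∀ {k}, Measurable k → ∀ i, MeasurableSet (S k i) := fun hk i =>
    (measurableSet_le measurable_norm measurable_const).inter
      (measurableSet_le hk measurable_const)
  have hS : ∀ {k : EuclideanSpace ℝ (Fin n) → ℝ}, Measurable k → ∫⁻ x, ENNReal.ofReal (k x) =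
      ⨆ i, ∫⁻ x, ENNReal.ofReal ((S k i).indicator k x) := by
    intro k hk
    have hmono : Monotone (S k) := fun i j hij x hx =>
      ⟨hx.1.trans (by exact_mod_cast hij), hx.2.trans (by exact_mod_cast hij)⟩
    have huniv : ⋃ i, S k i = univ := eq_univ_of_forall fun x => by
      obtain ⟨i, hi⟩ := exists_nat_ge (max ‖x‖ (k x))
      exact mem_iUnion.2 ⟨i, (le_max_left _ _).trans hi, (le_max_right _ _).trans hi⟩
    rw [← setLIntegral_univ, ← huniv, setLIntegral_iUnion_of_directed _ hmono.directed_le]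
    congr 1 with i
    rw [← lintegral_indicator (hSm hk i)]
    congr 1 with x
    by_cases hx : x ∈ S k i <;> simp [hx]
  have test : ∀ {k : EuclideanSpace ℝ (Fin n) → ℝ}, Measurable k → (∀ x, 0 ≤ k x) → ∀ i,
      IsTestDensity ((S k i).indicator k) := fun hk hk0 i =>
    ⟨hk.indicator (hSm hk i), indicator_nonneg fun x _ => hk0 x,
      ⟨i, fun x => indicator_apply_le' (fun hx => hx.2) fun _ => i.cast_nonneg⟩,
      i, fun x hx => indicator_of_notMem (fun h => h.1.not_gt hx) _⟩
  rw [hS hfm, hS hgm, ENNReal.iSup_mul]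
  refine iSup_le fun i => ?_
  rw [ENNReal.mul_iSup]
  refine iSup_le fun j => ?_
  refine lintegral_mul_lintegral_le_of_isTestDensity hcont hanti hpos h_int
    (test hfm hf0 i) (test hgm hg0 j) fun x y => le_trans ?_ (hfg x y)
  exact mul_le_mul (indicator_le_self' (fun x _ => hf0 x) x)
    (indicator_le_self' (fun x _ => hg0 x) y) ((test hgm hg0 j).nonneg y) (hf0 x)

end

/-- Duality for finite optimal transport. -/
theorem exists_finite_coupling {I J : Type*} [Fintype I] [Fintype J] {a : I → ℝ} {b : J → ℝ}
    (hasum : ∑ i, a i = 1) {c : I → J → ℝ}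
    (hc : ∀ i j, 0 ≤ c i j) {S : ℝ}
    (h : ∀ (φ : I → ℝ) (ψ : J → ℝ), (∀ i j, φ i + ψ j ≤ c i j) →
      ∑ i, φ i * a i + ∑ j, ψ j * b j ≤ S) :
    ∃ π : I → J → ℝ, (∀ i j, 0 ≤ π i j) ∧ (∀ i, ∑ j, π i j = a i) ∧ (∀ j, ∑ i, π i j = b j) ∧
      ∑ i, ∑ j, π i j * c i j ≤ S := by
  classical
  let T : (I × J → ℝ) → (I → ℝ) × (J → ℝ) × ℝ := fun p =>
    (fun i => ∑ j, p (i, j), fun j => ∑ i, p (i, j), ∑ i, ∑ j, p (i, j) * c i j)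
  have hTcont : Continuous T := by fun_prop
  have hTlin : IsLinearMap ℝ T := by
    refine ⟨fun p q => ?_, fun r p => ?_⟩
    · simp only [T, Pi.add_apply, Finset.sum_add_distrib, add_mul]
      rfl
    · simp only [T, Pi.smul_apply, smul_eq_mul, mul_assoc, ← Finset.mul_sum]
      rfl
  set A := T '' stdSimplex ℝ (I × J)
  set B : Set ((I → ℝ) × (J → ℝ) × ℝ) := {a} ×ˢ {b} ×ˢ Iic S
  by_cases hdisj : Disjoint A B
  swap
  · obtain ⟨_, ⟨p, hp, rfl⟩, hB⟩ := not_disjoint_iff.1 hdisj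
    obtain ⟨h1, h2, h3⟩ := hB
    exact ⟨fun i j => p (i, j), fun i j => hp.1 _, fun i => congrFun h1 i, fun j => congrFun h2 j,
      h3⟩
  exfalso
  obtain ⟨f, u, v, hA, huv, hB⟩ := geometric_hahn_banach_compact_closed
    ((convex_stdSimplex ℝ (I × J)).is_linear_image hTlin)
    ((isCompact_stdSimplex ℝ (I × J)).image hTcont)
    ((convex_singleton a).prod ((convex_singleton b).prod (convex_Iic S)))
    (isClosed_singleton.prod (isClosed_singleton.prod isClosed_Iic)) hdisj
  set α : I → ℝ := fun i => f (Pi.single i 1, 0, 0) with hα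
  set β : J → ℝ := fun j => f (0, Pi.single j 1, 0) with hβ
  set κ : ℝ := f (0, 0, 1) with hκ
  have hf : ∀ x y z, f (x, y, z) = ∑ i, α i * x i + ∑ j, β j * y j + κ * z := by
    intro x y z
    have h1 : (x, y, z) = ∑ i, x i • ((Pi.single i 1, 0, 0) : (I → ℝ) × (J → ℝ) × ℝ)
        + ∑ j, y j • ((0, Pi.single j 1, 0) : (I → ℝ) × (J → ℝ) × ℝ)
        + z • ((0, 0, 1) : (I → ℝ) × (J → ℝ) × ℝ) := by
      refine Prod.ext ?_ (Prod.ext ?_ ?_)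
      · funext k
        simp [Prod.fst_sum, Pi.single_apply]
      · funext k
        simp [Prod.fst_sum, Prod.snd_sum, Pi.single_apply]
      · simp [Prod.snd_sum]
    rw [h1, map_add, map_add, map_sum, map_sum, map_smul]
    simp only [map_smul, smul_eq_mul, mul_comm, hα, hβ, hκ]
  have hpoint : ∀ i j, α i + β j + κ * c i j < u := by
    intro i j
    have h1 := hA _ ⟨Pi.single (i, j) 1, single_mem_stdSimplex ℝ (i, j), rfl⟩
    have h2 : T (Pi.single (i, j) 1) = (Pi.single i 1, Pi.single j 1, c i j) := by
      refine Prod.ext ?_ (Prod.ext ?_ ?_)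
      · funext k
        by_cases hk : k = i <;> simp [T, Pi.single_apply, hk]
      · funext k
        by_cases hk : k = j <;> simp [T, Pi.single_apply, hk]
      · simp [T, Pi.single_apply, ite_and]
    rw [h2, hf] at h1
    simpa [Pi.single_apply] using h1
  have hval : ∀ s ≤ S, v < ∑ i, α i * a i + ∑ j, β j * b j + κ * s := fun s hs =>
    hf a b s ▸ hB (a, b, s) ⟨rfl, rfl, hs⟩
  set V := ∑ i, α i * a i + ∑ j, β j * b j
  have hκ0 : κ ≤ 0 := by
    by_contra! hκ0
    have := hval (min S ((v - V) / κ)) (min_le_left _ _)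
    have h2 : κ * min S ((v - V) / κ) ≤ κ * ((v - V) / κ) :=
      mul_le_mul_of_nonneg_left (min_le_right _ _) hκ0.le
    rw [mul_div_cancel₀ _ hκ0.ne'] at h2
    linarith
  have scaled : ∀ N : ℝ, 0 ≤ N → (∀ i j, N * (α i + β j - u) ≤ c i j) → N * (V - u) ≤ S := by
    intro N hN hNc
    have := h (fun i => N * (α i - u)) (fun j => N * β j)
      (fun i j => by have := hNc i j; linarith)
    calc N * (V - u) = N * (∑ i, α i * a i - u * ∑ i, a i) + N * ∑ j, β j * b j := by
          rw [hasum]; ring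
      _ = _ := by
          rw [Finset.mul_sum, ← Finset.sum_sub_distrib, Finset.mul_sum, Finset.mul_sum]
          congr 1 <;> refine Finset.sum_congr rfl fun i _ => by ring
      _ ≤ S := this
  have hS := hval S le_rfl
  rcases hκ0.eq_or_lt with h0 | h0
  · rw [h0, zero_mul, add_zero] at hS
    have hVu : 0 < V - u := by linarith
    have := scaled ((|S| + 1) / (V - u)) (by positivity) fun i j => by
      refine le_trans (mul_nonpos_of_nonneg_of_nonpos (by positivity) ?_) (hc i j)
      have := hpoint i j
      rw [h0] at this
      linarith
    rw [div_mul_cancel₀ _ hVu.ne'] at this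
    linarith [le_abs_self S]
  · have := scaled (-κ)⁻¹ (by rw [inv_nonneg]; linarith) fun i j => by
      rw [inv_mul_le_iff₀ (by linarith)]
      linarith [hpoint i j]
    rw [inv_mul_le_iff₀ (by linarith)] at this
    linarith

/-- A coupling of the images of two measures under a map with finitely many values lifts to a
coupling of the measures. -/
theorem exists_mem_coupling_lintegral_le {E I : Type*} [MeasurableSpace E] [Fintype I]
    [MeasurableSpace I] [MeasurableSingletonClass I] {q : E → I} (hq : Measurable q)
    (ν₁ ν₂ : Measure E) [IsProbabilityMeasure ν₁] [IsProbabilityMeasure ν₂] {π : I → I → ℝ}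
    (hπ : ∀ i j, 0 ≤ π i j) (h₁ : ∀ i, ∑ j, π i j = ν₁.real (q ⁻¹' {i}))
    (h₂ : ∀ j, ∑ i, π i j = ν₂.real (q ⁻¹' {j})) :
    ∃ γ ∈ Coupling ν₁ ν₂, ∀ k : I → I → ℝ≥0∞,
      ∫⁻ p, k (q p.1) (q p.2) ∂γ ≤ ∑ i, ∑ j, ENNReal.ofReal (π i j) * k i j := by
  have hQ : ∀ i, MeasurableSet (q ⁻¹' {i}) := fun i => hq (measurableSet_singleton i)
  let C : Measure E → I → Measure E := fun ν i => ProbabilityTheory.cond ν (q ⁻¹' {i})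
  have hsum : ∀ (ν : Measure E) [IsProbabilityMeasure ν], ∑ i, ν (q ⁻¹' {i}) • C ν i = ν := by
    intro ν _
    have h1 : ∀ i, ν (q ⁻¹' {i}) • C ν i = ν.restrict (q ⁻¹' {i}) := by
      intro i
      by_cases h0 : ν (q ⁻¹' {i}) = 0
      · rw [h0, zero_smul, Measure.restrict_eq_zero.2 h0]
      · rw [show C ν i = (ν (q ⁻¹' {i}))⁻¹ • ν.restrict (q ⁻¹' {i}) from rfl, smul_smul,
          ENNReal.mul_inv_cancel h0 (measure_ne_top _ _),
          one_smul]
    ext s hs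
    simp_rw [h1, Measure.coe_finsetSum, Finset.sum_apply, Measure.restrict_apply hs]
    rw [← measure_biUnion_finset (fun i _ j _ hij => ?_) fun i _ => hs.inter (hQ i)]
    · congr 1
      ext x
      simp
    · refine (Disjoint.preimage q (disjoint_singleton.2 hij)).mono inter_subset_right
        inter_subset_right
  have hmass : ∀ (ν : Measure E) [IsProbabilityMeasure ν] (i : I) (t : ℝ), 0 ≤ t →
      t ≤ ν.real (q ⁻¹' {i}) → ENNReal.ofReal t * C ν i univ = ENNReal.ofReal t := by
    intro ν _ i t ht0 ht
    by_cases h0 : ν (q ⁻¹' {i}) = 0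
    · rw [Measure.real, h0, ENNReal.toReal_zero] at ht
      simp [le_antisymm ht ht0]
    · have := ProbabilityTheory.cond_isProbabilityMeasure h0
      rw [show C ν i univ = 1 from measure_univ, mul_one]
  have hmass_le : ∀ (ν : Measure E) [IsProbabilityMeasure ν] (i : I), C ν i univ ≤ 1 := by
    intro ν _ i
    exact prob_le_one
  have hfin : ∀ (ν : Measure E) [IsProbabilityMeasure ν] (i : I), IsFiniteMeasure (C ν i) :=
    fun ν _ i => ⟨(hmass_le ν i).trans_lt ENNReal.one_lt_top⟩
  have hae : ∀ (ν : Measure E) [IsProbabilityMeasure ν] (i : I), ∀ᵐ x ∂C ν i, q x = i :=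
    fun ν _ i => ProbabilityTheory.ae_cond_mem (hQ i)
  refine ⟨∑ i, ∑ j, ENNReal.ofReal (π i j) • (C ν₁ i).prod (C ν₂ j), ⟨?_, ?_⟩, fun k => ?_⟩
  · ext s hs
    rw [Measure.map_apply measurable_fst hs, ← prod_univ]
    simp only [Measure.coe_finsetSum, Finset.sum_apply, Measure.smul_apply, smul_eq_mul]
    conv_rhs => rw [← hsum ν₁]
    simp only [Measure.coe_finsetSum, Finset.sum_apply, Measure.smul_apply, smul_eq_mul]
    refine Finset.sum_congr rfl fun i _ => ?_
    rw [← ofReal_measureReal, ← h₁, ENNReal.ofReal_sum_of_nonneg fun j _ => hπ i j,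
      Finset.sum_mul]
    refine Finset.sum_congr rfl fun j _ => ?_
    have := hfin ν₂ j
    rw [Measure.prod_prod, mul_comm (C ν₁ i s), ← mul_assoc, hmass ν₂ j _ (hπ i j)]
    exact h₂ j ▸ Finset.single_le_sum (f := fun i => π i j) (fun i _ => hπ i j)
      (Finset.mem_univ i)
  · ext s hs
    rw [Measure.map_apply measurable_snd hs, ← univ_prod]
    simp only [Measure.coe_finsetSum, Finset.sum_apply, Measure.smul_apply, smul_eq_mul]
    conv_rhs => rw [← hsum ν₂]
    simp only [Measure.coe_finsetSum, Finset.sum_apply, Measure.smul_apply, smul_eq_mul]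
    rw [Finset.sum_comm]
    refine Finset.sum_congr rfl fun j _ => ?_
    rw [← ofReal_measureReal, ← h₂, ENNReal.ofReal_sum_of_nonneg fun i _ => hπ i j,
      Finset.sum_mul]
    refine Finset.sum_congr rfl fun i _ => ?_
    have := hfin ν₂ j
    rw [Measure.prod_prod, ← mul_assoc, hmass ν₁ i _ (hπ i j)]
    exact h₁ i ▸ Finset.single_le_sum (f := fun j => π i j) (fun j _ => hπ i j)
      (Finset.mem_univ j)
  · simp only [lintegral_finsetSum_measure, lintegral_smul_measure, smul_eq_mul]
    gcongr with i _ j _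
    have := hfin ν₁ i
    have := hfin ν₂ j
    have h1 := Measure.quasiMeasurePreserving_fst (μ := C ν₁ i) (ν := C ν₂ j) |>.ae (hae ν₁ i)
    have h2 := Measure.quasiMeasurePreserving_snd (μ := C ν₁ i) (ν := C ν₂ j) |>.ae (hae ν₂ j)
    calc ∫⁻ p, k (q p.1) (q p.2) ∂(C ν₁ i).prod (C ν₂ j)
        = ∫⁻ _, k i j ∂(C ν₁ i).prod (C ν₂ j) := by
          refine lintegral_congr_ae ?_
          filter_upwards [h1, h2] with p hp hp'
          rw [hp, hp']
      _ = k i j * (C ν₁ i univ * C ν₂ j univ) := by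
          rw [lintegral_const, ← univ_prod_univ, Measure.prod_prod]
      _ ≤ k i j * (1 * 1) := by gcongr <;> exact hmass_le _ _
      _ = k i j := by simp

section

variable {E : Type*} [MeasurableSpace E] {μ ν : Measure E} [IsProbabilityMeasure μ]
  [IsProbabilityMeasure ν]

/-- Gibbs variational inequality. -/
theorem integral_le_integral_llr_add_log (hac : ν ≪ μ) (hllr : Integrable (llr ν μ) ν) {φ : E → ℝ}
    (hφν : Integrable φ ν) (hφμ : Integrable (fun x => Real.exp (φ x)) μ) :
    ∫ x, φ x ∂ν ≤ ∫ x, llr ν μ x ∂ν + Real.log (∫ x, Real.exp (φ x) ∂μ) := by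
  have := isProbabilityMeasure_tilted hφμ
  have h := InformationTheory.integral_llr_add_sub_measure_univ_nonneg
    (hac.trans (absolutelyContinuous_tilted hφμ)) (integrable_llr_tilted_right hac hφν hllr hφμ)
  rw [integral_llr_tilted_right hac hφν hφμ hllr] at h
  rw [probReal_univ, probReal_univ] at h
  linarith

theorem lintegral_ofReal_ne_top_of_integrable_exp (hac : ν ≪ μ) (hllr : Integrable (llr ν μ) ν)
    {w : E → ℝ} (hw : Measurable w) (hw0 : ∀ x, 0 ≤ w x) {l : ℝ} (hl : 0 < l)
    (hexp : Integrable (fun x => Real.exp (l * w x)) μ) :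
    ∫⁻ x, ENNReal.ofReal (w x) ∂ν ≠ ⊤ := by
  set M := ∫ x, llr ν μ x ∂ν + Real.log (∫ x, Real.exp (l * w x) ∂μ)
  let φ : ℕ → E → ℝ := fun k x => min (l * w x) k
  have hφm : ∀ k, Measurable (φ k) := fun k => (hw.const_mul l).min measurable_const
  have hφ0 : ∀ k x, 0 ≤ φ k x := fun k x => le_min (mul_nonneg hl.le (hw0 x)) k.cast_nonneg
  have hφk : ∀ k x, φ k x ≤ k := fun k x => min_le_right _ _
  have hφν : ∀ k, Integrable (φ k) ν := fun k =>
    Integrable.of_bound (hφm k).aestronglyMeasurable k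
      (ae_of_all _ fun x => by rw [Real.norm_of_nonneg (hφ0 k x)]; exact hφk k x)
  have hφμ : ∀ k, Integrable (fun x => Real.exp (φ k x)) μ := fun k =>
    hexp.mono' (hφm k).exp.aestronglyMeasurable
      (ae_of_all _ fun x => by
        rw [Real.norm_of_nonneg (Real.exp_pos _).le, Real.exp_le_exp]; exact min_le_left _ _)
  have hle : ∀ k, ∫⁻ x, ENNReal.ofReal (φ k x) ∂ν ≤ ENNReal.ofReal M := by
    intro k
    rw [← ofReal_integral_eq_lintegral_ofReal (hφν k) (ae_of_all _ (hφ0 k))]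
    refine ENNReal.ofReal_le_ofReal
      ((integral_le_integral_llr_add_log hac hllr (hφν k) (hφμ k)).trans ?_)
    have hpos : 0 < ∫ x, Real.exp (φ k x) ∂μ := integral_exp_pos (hφμ k)
    exact add_le_add le_rfl (Real.log_le_log hpos
      (integral_mono (hφμ k) hexp fun x => Real.exp_le_exp.2 (min_le_left _ _)))
  have hsup : ∫⁻ x, ENNReal.ofReal (l * w x) ∂ν = ⨆ k, ∫⁻ x, ENNReal.ofReal (φ k x) ∂ν := by
    rw [← lintegral_iSup fun k => (hφm k).ennreal_ofReal]
    · congr 1 with x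
      obtain ⟨k, hk⟩ := exists_nat_ge (l * w x)
      refine le_antisymm (le_iSup_of_le k ?_) (iSup_le fun k =>
        ENNReal.ofReal_le_ofReal (min_le_left _ _))
      exact ENNReal.ofReal_le_ofReal (le_min le_rfl hk)
    · intro i j hij x
      exact ENNReal.ofReal_le_ofReal (min_le_min le_rfl (by exact_mod_cast hij))
  have htop : ∫⁻ x, ENNReal.ofReal (l * w x) ∂ν ≠ ⊤ :=
    (hsup.trans_le (iSup_le hle)).trans_lt ENNReal.ofReal_lt_top |>.ne
  simp_rw [ENNReal.ofReal_mul hl.le] at htop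
  rw [lintegral_const_mul _ hw.ennreal_ofReal] at htop
  intro h
  rw [h, ENNReal.mul_top (by simpa using hl)] at htop
  exact htop rfl

end

/-- Positive continuous nonincreasing functions `ρ` on the half-line such that `ρ(|x|²)` is
integrable on `ℝⁿ` and `-log ρ(eᵗ)` is convex. -/
structure IsRadialWeight (n : ℕ) (ρ : ℝ → ℝ) : Prop where
  pos : ∀ t, 0 ≤ t → 0 < ρ t
  cont : ContinuousOn ρ (Ici 0)
  anti : AntitoneOn ρ (Ici 0)
  int : Integrable fun x : EuclideanSpace ℝ (Fin n) => ρ (‖x‖ ^ 2)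
  conv : ConvexOn ℝ univ fun t : ℝ => -Real.log (ρ (Real.exp t))

/-- The transport cost associated with a radial weight. -/
noncomputable def radialCost {n : ℕ} (ρ : ℝ → ℝ) (x y : EuclideanSpace ℝ (Fin n)) : ℝ :=
  Real.log (ρ |⟪x, y⟫| ^ 2 / (ρ (‖x‖ ^ 2) * ρ (‖y‖ ^ 2)))

/-- The potential of a radial weight, normalized to vanish at the origin. -/
noncomputable def radialPotential {n : ℕ} (ρ : ℝ → ℝ) (x : EuclideanSpace ℝ (Fin n)) : ℝ :=
  Real.log (ρ 0 / ρ (‖x‖ ^ 2))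

namespace IsRadialWeight

variable {n : ℕ} {ρ : ℝ → ℝ}

theorem pos_sq (hρ : IsRadialWeight n ρ) (t : ℝ) : 0 < ρ (t ^ 2) := hρ.pos _ (sq_nonneg t)

theorem anti_le (hρ : IsRadialWeight n ρ) {s t : ℝ} (hs : 0 ≤ s) (hst : s ≤ t) : ρ t ≤ ρ s :=
  hρ.anti (mem_Ici.2 hs) (mem_Ici.2 (hs.trans hst)) hst

theorem continuous_comp (hρ : IsRadialWeight n ρ) {X : Type*} [TopologicalSpace X] {u : X → ℝ}
    (hu : Continuous u) (hu0 : ∀ x, 0 ≤ u x) : Continuous fun x => ρ (u x) :=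
  hρ.cont.comp_continuous hu hu0

theorem mul_le_sq (hρ : IsRadialWeight n ρ) (x y : EuclideanSpace ℝ (Fin n)) :
    ρ (‖x‖ ^ 2) * ρ (‖y‖ ^ 2) ≤ ρ |⟪x, y⟫| ^ 2 := by
  have h0 := hρ.pos 0 le_rfl
  rcases eq_or_ne x 0 with rfl | hx
  · simpa [sq] using mul_le_mul_of_nonneg_left (hρ.anti_le le_rfl (sq_nonneg ‖y‖)) h0.le
  rcases eq_or_ne y 0 with rfl | hy
  · simpa [sq] using mul_le_mul_of_nonneg_right (hρ.anti_le le_rfl (sq_nonneg ‖x‖)) h0.le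
  have hx' := norm_pos_iff.2 hx
  have hy' := norm_pos_iff.2 hy
  have hexp : Real.exp ((1 / 2 : ℝ) * Real.log (‖x‖ ^ 2) + (1 / 2) * Real.log (‖y‖ ^ 2))
      = ‖x‖ * ‖y‖ := by
    rw [Real.log_pow, Real.log_pow]
    push_cast
    rw [show (1 / 2 : ℝ) * (2 * Real.log ‖x‖) + 1 / 2 * (2 * Real.log ‖y‖)
      = Real.log ‖x‖ + Real.log ‖y‖ by ring, Real.exp_add, Real.exp_log hx', Real.exp_log hy']
  have hconv := hρ.conv.2 (mem_univ (Real.log (‖x‖ ^ 2))) (mem_univ (Real.log (‖y‖ ^ 2)))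
    (by norm_num : (0 : ℝ) ≤ 1 / 2) (by norm_num : (0 : ℝ) ≤ 1 / 2) (by norm_num)
  simp only [smul_eq_mul, hexp, Real.exp_log (pow_pos hx' 2), Real.exp_log (pow_pos hy' 2)]
    at hconv
  have hxy := hρ.pos (‖x‖ * ‖y‖) (by positivity)
  have hlog : Real.log (ρ (‖x‖ ^ 2) * ρ (‖y‖ ^ 2)) ≤ Real.log (ρ (‖x‖ * ‖y‖) ^ 2) := by
    rw [Real.log_mul (hρ.pos_sq _).ne' (hρ.pos_sq _).ne', Real.log_pow]
    push_cast
    linarith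
  refine ((Real.log_le_log_iff (mul_pos (hρ.pos_sq _) (hρ.pos_sq _)) (by positivity)).1
    hlog).trans ?_
  gcongr
  exact hρ.anti_le (abs_nonneg _) (abs_real_inner_le_norm x y)

theorem radialCost_nonneg (hρ : IsRadialWeight n ρ) (x y : EuclideanSpace ℝ (Fin n)) :
    0 ≤ radialCost ρ x y :=
  Real.log_nonneg ((one_le_div (mul_pos (hρ.pos_sq _) (hρ.pos_sq _))).2 (hρ.mul_le_sq x y))

theorem exp_radialCost_mul (hρ : IsRadialWeight n ρ) (x y : EuclideanSpace ℝ (Fin n)) :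
    Real.exp (radialCost ρ x y) * (ρ (‖x‖ ^ 2) * ρ (‖y‖ ^ 2)) = ρ |⟪x, y⟫| ^ 2 := by
  have h := mul_pos (hρ.pos_sq ‖x‖) (hρ.pos_sq ‖y‖)
  rw [radialCost, Real.exp_log (div_pos (pow_pos (hρ.pos _ (abs_nonneg _)) 2) h),
    div_mul_cancel₀ _ h.ne']

theorem continuous_radialCost (hρ : IsRadialWeight n ρ) :
    Continuous fun p : EuclideanSpace ℝ (Fin n) × EuclideanSpace ℝ (Fin n) =>
      radialCost ρ p.1 p.2 := by
  have h1 : Continuous fun p : EuclideanSpace ℝ (Fin n) × EuclideanSpace ℝ (Fin n) =>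
      ρ |⟪p.1, p.2⟫| := hρ.continuous_comp (by fun_prop) fun _ => abs_nonneg _
  have h2 : Continuous fun p : EuclideanSpace ℝ (Fin n) × EuclideanSpace ℝ (Fin n) =>
      ρ (‖p.1‖ ^ 2) := hρ.continuous_comp (by fun_prop) fun _ => sq_nonneg _
  have h3 : Continuous fun p : EuclideanSpace ℝ (Fin n) × EuclideanSpace ℝ (Fin n) =>
      ρ (‖p.2‖ ^ 2) := hρ.continuous_comp (by fun_prop) fun _ => sq_nonneg _
  refine ((h1.pow 2).div (h2.mul h3) fun p => (mul_pos (hρ.pos_sq _) (hρ.pos_sq _)).ne').log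
    fun p => ?_
  exact (div_pos (pow_pos (hρ.pos _ (abs_nonneg _)) 2)
    (mul_pos (hρ.pos_sq _) (hρ.pos_sq _))).ne'

theorem continuous_radialPotential (hρ : IsRadialWeight n ρ) :
    Continuous (radialPotential ρ : EuclideanSpace ℝ (Fin n) → ℝ) := by
  have h : Continuous fun x : EuclideanSpace ℝ (Fin n) => ρ (‖x‖ ^ 2) :=
    hρ.continuous_comp (by fun_prop) fun _ => sq_nonneg _
  exact (continuous_const.div h fun x => (hρ.pos_sq _).ne').log fun x =>
    (div_pos (hρ.pos 0 le_rfl) (hρ.pos_sq _)).ne'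

theorem radialPotential_mono (hρ : IsRadialWeight n ρ) {x y : EuclideanSpace ℝ (Fin n)}
    (h : ‖x‖ ≤ ‖y‖) : radialPotential ρ x ≤ radialPotential ρ y := by
  have h0 := hρ.pos 0 le_rfl
  refine Real.log_le_log (div_pos h0 (hρ.pos_sq _)) ?_
  exact div_le_div_of_nonneg_left h0.le (hρ.pos_sq _) (hρ.anti_le (sq_nonneg _) (by gcongr))

theorem radialPotential_nonneg (hρ : IsRadialWeight n ρ) (x : EuclideanSpace ℝ (Fin n)) :
    0 ≤ radialPotential ρ x := by
  have h := hρ.radialPotential_mono (x := 0) (y := x) (by simp)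
  simpa [radialPotential, (hρ.pos 0 le_rfl).ne'] using h

theorem radialCost_le (hρ : IsRadialWeight n ρ) (x y : EuclideanSpace ℝ (Fin n)) :
    radialCost ρ x y ≤ radialPotential ρ x + radialPotential ρ y := by
  have h0 := hρ.pos 0 le_rfl
  have hx := hρ.pos_sq ‖x‖
  have hy := hρ.pos_sq ‖y‖
  have hxy := hρ.pos _ (abs_nonneg ⟪x, y⟫)
  rw [radialCost, radialPotential, radialPotential,
    ← Real.log_mul (div_pos h0 hx).ne' (div_pos h0 hy).ne', div_mul_div_comm, ← sq]
  refine Real.log_le_log (by positivity) ?_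
  gcongr
  exact hρ.anti_le le_rfl (abs_nonneg _)

theorem exists_pow_mul_lt (hρ : IsRadialWeight n ρ) (hn : n ≠ 0) :
    ∃ y, 1 < y ∧ y ^ n * ρ (y ^ 2) < ρ 1 := by
  by_contra! h
  have : Nonempty (Fin n) := ⟨⟨0, Nat.pos_of_ne_zero hn⟩⟩
  have h_int := hρ.int
  rw [integrable_fun_norm_addHaar volume (f := fun y => ρ (y ^ 2)), finrank_euclideanSpace_fin]
    at h_int
  have h1 := hρ.pos 1 zero_le_one
  refine not_integrableOn_Ioi_inv (a := 1) ?_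
  refine ((h_int.mono_set (Ioi_subset_Ioi zero_le_one)).div_const (ρ 1)).mono'
    (by fun_prop) ?_
  refine (ae_restrict_iff' measurableSet_Ioi).2 (ae_of_all _ fun y hy => ?_)
  have hy0 : 0 < y := zero_lt_one.trans hy
  rw [Real.norm_of_nonneg (inv_nonneg.2 hy0.le), le_div_iff₀ h1, inv_mul_le_iff₀ hy0, smul_eq_mul,
    ← mul_assoc, ← pow_succ', Nat.sub_add_cancel (Nat.pos_of_ne_zero hn)]
  exact h y hy

/-- Convexity upgrades integrability to a polynomial decay rate better than the critical one. -/
theorem exists_decay (hρ : IsRadialWeight n ρ) (hn : n ≠ 0) :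
    ∃ C s : ℝ, 0 < C ∧ (n : ℝ) < s ∧ ∀ y, 0 ≤ y → ρ (y ^ 2) ≤ C * (1 + y) ^ (-s) := by
  obtain ⟨y₁, hy₁, hlt⟩ := hρ.exists_pow_mul_lt hn
  have hy₁0 : 0 < y₁ := zero_lt_one.trans hy₁
  have h0 := hρ.pos 0 le_rfl
  have h1 := hρ.pos 1 zero_le_one
  have hl₁ : 0 < Real.log y₁ := Real.log_pos hy₁
  set s := (Real.log (ρ 1) - Real.log (ρ (y₁ ^ 2))) / Real.log y₁ with hs
  have hns : (n : ℝ) < s := by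
    have := Real.log_lt_log (mul_pos (pow_pos hy₁0 n) (hρ.pos_sq _)) hlt
    rw [Real.log_mul (pow_pos hy₁0 n).ne' (hρ.pos_sq _).ne', Real.log_pow] at this
    rw [hs, lt_div_iff₀ hl₁]
    linarith
  have hs0 : 0 < s := (Nat.cast_nonneg n).trans_lt hns
  have hdecay : ∀ y, y₁ ≤ y → ρ (y ^ 2) ≤ ρ 1 * y ^ (-s) := by
    intro y hy
    have hy0 : 0 < y := hy₁0.trans_le hy
    have hl : Real.log y₁ ≤ Real.log y := Real.log_le_log hy₁0 hy
    have hl0 : 0 < Real.log y := hl₁.trans_le hl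
    have hθ : Real.log y₁ / Real.log y ≤ 1 := (div_le_one hl0).2 hl
    have hconv := hρ.conv.2 (mem_univ 0) (mem_univ (Real.log (y ^ 2)))
      (sub_nonneg.2 hθ) (div_nonneg hl₁.le hl0.le) (by ring)
    have hmid : Real.log y₁ / Real.log y * Real.log (y ^ 2) = Real.log (y₁ ^ 2) := by
      rw [Real.log_pow, Real.log_pow]
      field_simp
    simp only [smul_eq_mul, mul_zero, zero_add, hmid, Real.exp_zero,
      Real.exp_log (pow_pos hy0 2), Real.exp_log (pow_pos hy₁0 2)] at hconv
    have hlog : Real.log (ρ (y ^ 2)) ≤ Real.log (ρ 1 * y ^ (-s)) := by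
      rw [Real.log_mul h1.ne' (Real.rpow_pos_of_pos hy0 _).ne', Real.log_rpow hy0, hs]
      have h2 := mul_le_mul_of_nonneg_left hconv (div_pos hl0 hl₁).le
      field_simp at h2 ⊢
      nlinarith
    exact (Real.log_le_log_iff (hρ.pos_sq _) (mul_pos h1 (Real.rpow_pos_of_pos hy0 _))).1 hlog
  refine ⟨ρ 0 * (1 + y₁) ^ s + ρ 1 * 2 ^ s, s, by positivity, hns, fun y hy => ?_⟩
  have hy' : 0 < 1 + y := by linarith
  rw [Real.rpow_neg hy'.le, ← div_eq_mul_inv, le_div_iff₀ (Real.rpow_pos_of_pos hy' _)]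
  rcases le_total y₁ y with h | h
  · have hy0 : 0 < y := hy₁0.trans_le h
    have : (1 + y) ^ s ≤ 2 ^ s * y ^ s := by
      rw [← Real.mul_rpow zero_le_two hy]
      exact Real.rpow_le_rpow hy'.le (by linarith) hs0.le
    calc ρ (y ^ 2) * (1 + y) ^ s ≤ ρ 1 * y ^ (-s) * (2 ^ s * y ^ s) :=
          mul_le_mul (hdecay y h) this (by positivity) (by positivity)
      _ = ρ 1 * 2 ^ s := by
          rw [Real.rpow_neg hy]
          have := (Real.rpow_pos_of_pos hy0 s).ne'
          field_simp
      _ ≤ _ := le_add_of_nonneg_left (by positivity)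
  · calc ρ (y ^ 2) * (1 + y) ^ s ≤ ρ 0 * (1 + y₁) ^ s :=
          mul_le_mul (hρ.anti_le le_rfl (sq_nonneg _))
            (Real.rpow_le_rpow hy'.le (by linarith) hs0.le) (by positivity) h0.le
      _ ≤ _ := le_add_of_nonneg_right (by positivity)

theorem exp_radialPotential_mul (hρ : IsRadialWeight n ρ) (l : ℝ)
    (x : EuclideanSpace ℝ (Fin n)) :
    Real.exp (l * radialPotential ρ x) * ρ (‖x‖ ^ 2) = ρ 0 ^ l * ρ (‖x‖ ^ 2) ^ (1 - l) := by
  have h0 := hρ.pos 0 le_rfl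
  have hx := hρ.pos_sq ‖x‖
  rw [radialPotential, mul_comm l, ← Real.rpow_def_of_pos (div_pos h0 hx),
    Real.div_rpow h0.le hx.le, Real.rpow_sub hx, Real.rpow_one]
  field_simp

theorem exists_integrable_exp_radialPotential (hρ : IsRadialWeight n ρ) :
    ∃ l : ℝ, 0 < l ∧ Integrable fun x : EuclideanSpace ℝ (Fin n) =>
      Real.exp (l * radialPotential ρ x) * ρ (‖x‖ ^ 2) := by
  have hcont : ∀ l : ℝ, Continuous fun x : EuclideanSpace ℝ (Fin n) =>
      Real.exp (l * radialPotential ρ x) * ρ (‖x‖ ^ 2) := fun l =>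
    (Real.continuous_exp.comp (continuous_const.mul hρ.continuous_radialPotential)).mul
      (hρ.continuous_comp (by fun_prop) fun _ => sq_nonneg _)
  rcases eq_or_ne n 0 with rfl | hn
  · exact ⟨1, one_pos, (hcont 1).integrable_of_hasCompactSupport (.of_compactSpace _)⟩
  obtain ⟨C, s, hC, hns, hdecay⟩ := hρ.exists_decay hn
  obtain ⟨r, hnr, hrs⟩ := exists_between hns
  have hs0 : 0 < s := (Nat.cast_nonneg n).trans_lt hns
  have hr0 : 0 < r := (Nat.cast_nonneg n).trans_lt hnr
  have h0 := hρ.pos 0 le_rfl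
  refine ⟨1 - r / s, sub_pos.2 ((div_lt_one hs0).2 hrs), ?_⟩
  have h_int : Integrable fun x : EuclideanSpace ℝ (Fin n) => (1 + ‖x‖) ^ (-r) :=
    integrable_one_add_norm (by rwa [finrank_euclideanSpace_fin])
  refine (h_int.const_mul (ρ 0 ^ (1 - r / s) * C ^ (r / s))).mono'
    (hcont _).aestronglyMeasurable (ae_of_all _ fun x => ?_)
  have hx : 0 < 1 + ‖x‖ := by positivity
  have hpos := hρ.pos_sq ‖x‖
  rw [Real.norm_of_nonneg (by positivity), hρ.exp_radialPotential_mul, sub_sub_cancel, mul_assoc]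
  refine mul_le_mul_of_nonneg_left ?_ (by positivity)
  calc ρ (‖x‖ ^ 2) ^ (r / s) ≤ (C * (1 + ‖x‖) ^ (-s)) ^ (r / s) :=
        Real.rpow_le_rpow hpos.le (hdecay _ (norm_nonneg _)) (by positivity)
    _ = C ^ (r / s) * (1 + ‖x‖) ^ (-r) := by
        rw [Real.mul_rpow hC.le (by positivity), ← Real.rpow_mul hx.le]
        congr 2
        field_simp

end IsRadialWeight

/-- The measure with density proportional to `ρ(|x|²)`. -/
noncomputable def radialMeasure (n : ℕ) (ρ : ℝ → ℝ) : Measure (EuclideanSpace ℝ (Fin n)) :=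
  volume.withDensity fun x =>
    ENNReal.ofReal (ρ (‖x‖ ^ 2) / ∫ y : EuclideanSpace ℝ (Fin n), ρ (‖y‖ ^ 2))

namespace IsRadialWeight

variable {n : ℕ} {ρ : ℝ → ℝ}

theorem integral_pos (hρ : IsRadialWeight n ρ) :
    0 < ∫ y : EuclideanSpace ℝ (Fin n), ρ (‖y‖ ^ 2) := by
  refine (integral_pos_iff_support_of_nonneg (fun x => (hρ.pos_sq _).le) hρ.int).2 ?_
  rw [show Function.support (fun x : EuclideanSpace ℝ (Fin n) => ρ (‖x‖ ^ 2)) = univ from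
    eq_univ_of_forall fun x => (hρ.pos_sq _).ne']
  exact Measure.measure_univ_pos.2 (NeZero.ne _)

theorem measurable_comp_norm_sq (hρ : IsRadialWeight n ρ) :
    Measurable fun x : EuclideanSpace ℝ (Fin n) => ρ (‖x‖ ^ 2) :=
  (hρ.continuous_comp (by fun_prop) fun _ => sq_nonneg _).measurable

theorem lintegral_radialMeasure (hρ : IsRadialWeight n ρ) {f : EuclideanSpace ℝ (Fin n) → ℝ}
    (hf : Measurable f) (hf0 : ∀ x, 0 ≤ f x) :
    ∫⁻ x, ENNReal.ofReal (f x) ∂radialMeasure n ρ =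
      (∫⁻ x, ENNReal.ofReal (f x * ρ (‖x‖ ^ 2))) /
        ENNReal.ofReal (∫ y : EuclideanSpace ℝ (Fin n), ρ (‖y‖ ^ 2)) := by
  have hZ := hρ.integral_pos
  rw [radialMeasure, lintegral_withDensity_eq_lintegral_mul _
    (hρ.measurable_comp_norm_sq.div_const _).ennreal_ofReal hf.ennreal_ofReal, div_eq_mul_inv,
    ← lintegral_mul_const _ (by
      exact (hf.mul hρ.measurable_comp_norm_sq).ennreal_ofReal)]
  refine lintegral_congr fun x => ?_
  rw [Pi.mul_apply, ENNReal.ofReal_div_of_pos hZ, ENNReal.ofReal_mul (hf0 x), div_eq_mul_inv]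
  ring

theorem isProbabilityMeasure_radialMeasure (hρ : IsRadialWeight n ρ) :
    IsProbabilityMeasure (radialMeasure n ρ) := by
  refine ⟨?_⟩
  have h := hρ.lintegral_radialMeasure (f := fun _ => 1) measurable_const fun _ => zero_le_one
  simp only [ENNReal.ofReal_one, lintegral_one, one_mul] at h
  rw [h, ← ofReal_integral_eq_lintegral_ofReal hρ.int (ae_of_all _ fun x => (hρ.pos_sq _).le)]
  exact ENNReal.div_self (by simpa using hρ.integral_pos) ENNReal.ofReal_ne_top

theorem exists_integrable_exp (hρ : IsRadialWeight n ρ) :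
    ∃ l : ℝ, 0 < l ∧
      Integrable (fun x => Real.exp (l * radialPotential ρ x)) (radialMeasure n ρ) := by
  obtain ⟨l, hl, h_int⟩ := hρ.exists_integrable_exp_radialPotential
  refine ⟨l, hl, ?_⟩
  have hZ := hρ.integral_pos
  rw [radialMeasure, integrable_withDensity_iff_integrable_smul'
    (hρ.measurable_comp_norm_sq.div_const _).ennreal_ofReal
    (ae_of_all _ fun x => ENNReal.ofReal_lt_top)]
  refine (h_int.div_const (∫ y : EuclideanSpace ℝ (Fin n), ρ (‖y‖ ^ 2))).congr
    (ae_of_all _ fun x => ?_)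
  simp only
  rw [ENNReal.toReal_ofReal (div_nonneg (hρ.pos_sq _).le hZ.le), smul_eq_mul]
  ring

theorem lintegral_exp_mul_lintegral_exp_le (hρ : IsRadialWeight n ρ)
    {φ ψ : EuclideanSpace ℝ (Fin n) → ℝ} (hφ : Measurable φ) (hψ : Measurable ψ)
    (h : ∀ x y, φ x + ψ y ≤ radialCost ρ x y) :
    (∫⁻ x, ENNReal.ofReal (Real.exp (φ x)) ∂radialMeasure n ρ) *
      ∫⁻ y, ENNReal.ofReal (Real.exp (ψ y)) ∂radialMeasure n ρ ≤ 1 := by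
  have hle := lintegral_mul_lintegral_le hρ.cont hρ.anti hρ.pos hρ.int
    (f := fun x => Real.exp (φ x) * ρ (‖x‖ ^ 2)) (g := fun x => Real.exp (ψ x) * ρ (‖x‖ ^ 2))
    (hφ.exp.mul hρ.measurable_comp_norm_sq) (hψ.exp.mul hρ.measurable_comp_norm_sq)
    (fun x => mul_nonneg (Real.exp_pos _).le (hρ.pos_sq _).le)
    (fun x => mul_nonneg (Real.exp_pos _).le (hρ.pos_sq _).le) (fun x y => by
      rw [← hρ.exp_radialCost_mul x y, mul_mul_mul_comm, ← Real.exp_add]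
      exact mul_le_mul_of_nonneg_right (Real.exp_le_exp.2 (h x y))
        (mul_pos (hρ.pos_sq _) (hρ.pos_sq _)).le)
  have hZ : ENNReal.ofReal (∫ y : EuclideanSpace ℝ (Fin n), ρ (‖y‖ ^ 2)) ≠ 0 := by
    simpa using hρ.integral_pos
  rw [← ofReal_integral_eq_lintegral_ofReal hρ.int (ae_of_all _ fun x => (hρ.pos_sq _).le)] at hle
  rw [hρ.lintegral_radialMeasure hφ.exp fun x => (Real.exp_pos _).le,
    hρ.lintegral_radialMeasure hψ.exp fun x => (Real.exp_pos _).le, div_eq_mul_inv,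
    div_eq_mul_inv, mul_mul_mul_comm, ← sq (ENNReal.ofReal _)⁻¹, ← ENNReal.inv_pow,
    ← div_eq_mul_inv]
  exact ENNReal.div_le_of_le_mul (by rwa [one_mul])

theorem integral_add_integral_le (hρ : IsRadialWeight n ρ)
    {ν₁ ν₂ : Measure (EuclideanSpace ℝ (Fin n))} [IsProbabilityMeasure ν₁] [IsProbabilityMeasure ν₂]
    (hac₁ : ν₁ ≪ radialMeasure n ρ) (hllr₁ : Integrable (llr ν₁ (radialMeasure n ρ)) ν₁)
    (hac₂ : ν₂ ≪ radialMeasure n ρ) (hllr₂ : Integrable (llr ν₂ (radialMeasure n ρ)) ν₂)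
    {φ ψ : EuclideanSpace ℝ (Fin n) → ℝ} (hφ : Measurable φ) (hψ : Measurable ψ) {B : ℝ}
    (hφB : ∀ x, |φ x| ≤ B) (hψB : ∀ x, |ψ x| ≤ B) (h : ∀ x y, φ x + ψ y ≤ radialCost ρ x y) :
    ∫ x, φ x ∂ν₁ + ∫ y, ψ y ∂ν₂ ≤
      ∫ x, llr ν₁ (radialMeasure n ρ) x ∂ν₁ + ∫ x, llr ν₂ (radialMeasure n ρ) x ∂ν₂ := by
  have := hρ.isProbabilityMeasure_radialMeasure
  have hexp : ∀ {χ : EuclideanSpace ℝ (Fin n) → ℝ}, Measurable χ → (∀ x, |χ x| ≤ B) →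
      Integrable (fun x => Real.exp (χ x)) (radialMeasure n ρ) := fun hχ hB =>
    Integrable.of_bound hχ.exp.aestronglyMeasurable (Real.exp B) (ae_of_all _ fun x => by
      rw [Real.norm_of_nonneg (Real.exp_pos _).le, Real.exp_le_exp]
      exact (le_abs_self _).trans (hB x))
  have h₁ := integral_le_integral_llr_add_log hac₁ hllr₁
    (Integrable.of_bound hφ.aestronglyMeasurable B (ae_of_all _ hφB)) (hexp hφ hφB)
  have h₂ := integral_le_integral_llr_add_log hac₂ hllr₂
    (Integrable.of_bound hψ.aestronglyMeasurable B (ae_of_all _ hψB)) (hexp hψ hψB)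
  have hp₁ := integral_exp_pos (hexp hφ hφB)
  have hp₂ := integral_exp_pos (hexp hψ hψB)
  have hle := hρ.lintegral_exp_mul_lintegral_exp_le hφ hψ h
  rw [← ofReal_integral_eq_lintegral_ofReal (hexp hφ hφB)
      (ae_of_all _ fun x => (Real.exp_pos _).le),
    ← ofReal_integral_eq_lintegral_ofReal (hexp hψ hψB) (ae_of_all _ fun x => (Real.exp_pos _).le),
    ← ENNReal.ofReal_mul hp₁.le, ENNReal.ofReal_le_one] at hle
  have hlog := Real.log_nonpos (mul_pos hp₁ hp₂).le hle
  rw [Real.log_mul hp₁.ne' hp₂.ne'] at hlog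
  linarith

end IsRadialWeight

theorem sum_mul_measureReal_preimage {E I : Type*} [MeasurableSpace E] [Fintype I]
    [MeasurableSpace I] [MeasurableSingletonClass I] {q : E → I} (hq : Measurable q)
    (ν : Measure E) [IsFiniteMeasure ν] (φ : I → ℝ) :
    ∑ i, φ i * ν.real (q ⁻¹' {i}) = ∫ x, φ (q x) ∂ν := by
  rw [← integral_map hq.aemeasurable (measurable_of_finite φ).aestronglyMeasurable,
    integral_fintype .of_finite]
  refine Finset.sum_congr rfl fun i _ => ?_
  rw [map_measureReal_apply hq (measurableSet_singleton i), smul_eq_mul, mul_comm]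

/-- A finite-valued map separating points of `s` at scale `δ`, for `s` totally bounded. -/
theorem exists_finite_quantization {E : Type*} [PseudoMetricSpace E] [MeasurableSpace E]
    [OpensMeasurableSpace E] {s : Set E} (hs : TotallyBounded s) {δ : ℝ} (hδ : 0 < δ) :
    ∃ (m : ℕ) (q : E → Fin m → Prop), Measurable q ∧
      ∀ x ∈ s, ∀ y, q x = q y → dist x y < δ := by
  obtain ⟨t, ht, hst⟩ := Metric.totallyBounded_iff.1 hs (δ / 2) (half_pos hδ)
  obtain ⟨m, f, -, rfl⟩ := ht.fin_param
  refine ⟨m, fun x i => dist x (f i) < δ / 2, measurable_pi_iff.2 fun i =>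
    measurableSet_setOfPred.1 ?_, fun x hx y hxy => ?_⟩
  · exact (isOpen_lt (by fun_prop) continuous_const).measurableSet
  · obtain ⟨z, ⟨i, rfl⟩, hz⟩ := by simpa only [mem_iUnion, exists_prop] using hst hx
    have hxi : dist x (f i) < δ / 2 := hz
    have hyi : dist y (f i) < δ / 2 := (congrFun hxy i).mp hxi
    linarith [dist_triangle_right x y (f i)]

namespace IsRadialWeight

variable {n : ℕ} {ρ : ℝ → ℝ}

theorem exists_coupling_quantized (hρ : IsRadialWeight n ρ)
    {ν₁ ν₂ : Measure (EuclideanSpace ℝ (Fin n))} [IsProbabilityMeasure ν₁] [IsProbabilityMeasure ν₂]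
    (hac₁ : ν₁ ≪ radialMeasure n ρ) (hllr₁ : Integrable (llr ν₁ (radialMeasure n ρ)) ν₁)
    (hac₂ : ν₂ ≪ radialMeasure n ρ) (hllr₂ : Integrable (llr ν₂ (radialMeasure n ρ)) ν₂)
    {I : Type} [Fintype I] [MeasurableSpace I] [MeasurableSingletonClass I]
    {q : EuclideanSpace ℝ (Fin n) → I} (hq : Measurable q) {k : I → I → ℝ}
    (hk0 : ∀ i j, 0 ≤ k i j) (hk : ∀ x y, k (q x) (q y) ≤ radialCost ρ x y) :
    ∃ γ ∈ Coupling ν₁ ν₂, ∫⁻ p, ENNReal.ofReal (k (q p.1) (q p.2)) ∂γ ≤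
      ENNReal.ofReal (∫ x, llr ν₁ (radialMeasure n ρ) x ∂ν₁ +
        ∫ x, llr ν₂ (radialMeasure n ρ) x ∂ν₂) := by
  have hsum : ∑ i, ν₁.real (q ⁻¹' {i}) = 1 := by
    simpa using sum_mul_measureReal_preimage hq ν₁ fun _ => 1
  obtain ⟨π, hπ, h₁, h₂, hle⟩ := exists_finite_coupling hsum hk0
    (b := fun j => ν₂.real (q ⁻¹' {j})) (S := ∫ x, llr ν₁ (radialMeasure n ρ) x ∂ν₁ +
        ∫ x, llr ν₂ (radialMeasure n ρ) x ∂ν₂) (fun φ ψ hφψ => by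
      rw [sum_mul_measureReal_preimage hq, sum_mul_measureReal_preimage hq]
      refine hρ.integral_add_integral_le hac₁ hllr₁ hac₂ hllr₂
        ((measurable_of_finite φ).comp hq) ((measurable_of_finite ψ).comp hq)
        (B := ∑ i, |φ i| + ∑ i, |ψ i|) (fun x => ?_) (fun x => ?_)
        fun x y => (hφψ _ _).trans (hk x y)
      · exact (Finset.single_le_sum (f := fun i => |φ i|) (fun i _ => abs_nonneg _)
          (Finset.mem_univ (q x))).trans
          (le_add_of_nonneg_right (Finset.sum_nonneg fun i _ => abs_nonneg _))
      · exact (Finset.single_le_sum (f := fun i => |ψ i|) (fun i _ => abs_nonneg _)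
          (Finset.mem_univ (q x))).trans
          (le_add_of_nonneg_left (Finset.sum_nonneg fun i _ => abs_nonneg _)))
  obtain ⟨γ, hγ, hγk⟩ := exists_mem_coupling_lintegral_le hq ν₁ ν₂ hπ h₁ h₂
  refine ⟨γ, hγ, (hγk fun i j => ENNReal.ofReal (k i j)).trans ?_⟩
  simp_rw [← ENNReal.ofReal_mul (hπ _ _)]
  simp_rw [← ENNReal.ofReal_sum_of_nonneg fun j _ => mul_nonneg (hπ _ j) (hk0 _ j)]
  rw [← ENNReal.ofReal_sum_of_nonneg fun i _ =>
    Finset.sum_nonneg fun j _ => mul_nonneg (hπ i j) (hk0 i j)]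
  exact ENNReal.ofReal_le_ofReal hle

theorem exists_quantized_cost (hρ : IsRadialWeight n ρ) (R : ℝ) {ε : ℝ} (hε : 0 < ε) :
    ∃ (m : ℕ) (q : EuclideanSpace ℝ (Fin n) → Fin m → Prop)
      (k : (Fin m → Prop) → (Fin m → Prop) → ℝ), Measurable q ∧ (∀ i j, 0 ≤ k i j) ∧
      (∀ x y, k (q x) (q y) ≤ radialCost ρ x y) ∧
      ∀ x y, ‖x‖ ≤ R → ‖y‖ ≤ R → radialCost ρ x y ≤ k (q x) (q y) + ε := by
  have huc := ((isCompact_closedBall (0 : EuclideanSpace ℝ (Fin n)) (R + 1)).prod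
    (isCompact_closedBall (0 : EuclideanSpace ℝ (Fin n)) (R + 1))).uniformContinuousOn_of_continuous
    hρ.continuous_radialCost.continuousOn
  obtain ⟨δ, hδ, hδε⟩ := Metric.uniformContinuousOn_iff.1 huc ε hε
  obtain ⟨m, q, hq, hqδ⟩ := exists_finite_quantization
    (isCompact_closedBall (0 : EuclideanSpace ℝ (Fin n)) R).totallyBounded (lt_min hδ one_pos)
  let A : (Fin m → Prop) → (Fin m → Prop) → Set ℝ := fun i j =>
    (fun p : EuclideanSpace ℝ (Fin n) × EuclideanSpace ℝ (Fin n) => radialCost ρ p.1 p.2) ''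
      {p | q p.1 = i ∧ q p.2 = j}
  have hA0 : ∀ i j, ∀ r ∈ A i j, 0 ≤ r := by
    rintro i j _ ⟨p, -, rfl⟩
    exact hρ.radialCost_nonneg _ _
  refine ⟨m, q, fun i j => sInf (A i j), hq, fun i j => Real.sInf_nonneg (hA0 i j),
    fun x y => csInf_le ⟨0, hA0 _ _⟩ ⟨(x, y), ⟨rfl, rfl⟩, rfl⟩, fun x y hx hy => ?_⟩
  rw [← sub_le_iff_le_add]
  refine le_csInf ⟨_, (x, y), ⟨rfl, rfl⟩, rfl⟩ ?_
  rintro _ ⟨⟨x', y'⟩, ⟨hx', hy'⟩, rfl⟩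
  have hxx := hqδ x (by simpa using hx) x' hx'.symm
  have hyy := hqδ y (by simpa using hy) y' hy'.symm
  have hball : ∀ {u v : EuclideanSpace ℝ (Fin n)}, ‖u‖ ≤ R → dist u v < min δ 1 →
      v ∈ Metric.closedBall (0 : EuclideanSpace ℝ (Fin n)) (R + 1) := by
    intro u v hu huv
    rw [mem_closedBall_zero_iff]
    have h1 := huv.trans_le (min_le_right _ _)
    rw [dist_comm, dist_eq_norm] at h1
    linarith [norm_le_norm_add_norm_sub' v u]
  have := hδε (x, y) ⟨hball hx (by simpa using lt_min hδ one_pos),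
    hball hy (by simpa using lt_min hδ one_pos)⟩ (x', y') ⟨hball hx hxx, hball hy hyy⟩
    (max_lt (hxx.trans_le (min_le_left _ _)) (hyy.trans_le (min_le_left _ _)))
  rw [Real.dist_eq] at this
  linarith [(abs_lt.1 this).2]

theorem ofReal_radialCost_le (hρ : IsRadialWeight n ρ) {R a ε : ℝ}
    {x y : EuclideanSpace ℝ (Fin n)}
    (h : ‖x‖ ≤ R → ‖y‖ ≤ R → radialCost ρ x y ≤ a + ε) :
    ENNReal.ofReal (radialCost ρ x y) ≤ ENNReal.ofReal a + ENNReal.ofReal ε +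
      (2 * {z | R < ‖z‖}.indicator (fun z => ENNReal.ofReal (radialPotential ρ z)) x +
        2 * {z | R < ‖z‖}.indicator (fun z => ENNReal.ofReal (radialPotential ρ z)) y) := by
  have hle := hρ.radialCost_le x y
  by_cases hR : ‖x‖ ≤ R ∧ ‖y‖ ≤ R
  · exact ((ENNReal.ofReal_le_ofReal (h hR.1 hR.2)).trans ENNReal.ofReal_add_le).trans
      le_self_add
  have htwo : ∀ z : EuclideanSpace ℝ (Fin n), ENNReal.ofReal (2 * radialPotential ρ z) =
      2 * ENNReal.ofReal (radialPotential ρ z) := fun z => by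
    rw [ENNReal.ofReal_mul zero_le_two, ENNReal.ofReal_ofNat]
  refine le_trans ?_ le_add_self
  rcases le_total ‖x‖ ‖y‖ with hxy | hxy
  · have hy : y ∈ {z : EuclideanSpace ℝ (Fin n) | R < ‖z‖} :=
      lt_of_not_ge fun hy => hR ⟨hxy.trans hy, hy⟩
    rw [indicator_of_mem hy, ← htwo]
    refine le_trans (ENNReal.ofReal_le_ofReal ?_) le_add_self
    linarith [hρ.radialPotential_mono hxy]
  · have hx : x ∈ {z : EuclideanSpace ℝ (Fin n) | R < ‖z‖} :=
      lt_of_not_ge fun hx => hR ⟨hx, hxy.trans hx⟩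
    rw [indicator_of_mem hx, ← htwo]
    refine le_trans (ENNReal.ofReal_le_ofReal ?_) le_self_add
    linarith [hρ.radialPotential_mono hxy]

theorem transportCost_le_add_tails (hρ : IsRadialWeight n ρ)
    {ν₁ ν₂ : Measure (EuclideanSpace ℝ (Fin n))} [IsProbabilityMeasure ν₁] [IsProbabilityMeasure ν₂]
    (hac₁ : ν₁ ≪ radialMeasure n ρ) (hllr₁ : Integrable (llr ν₁ (radialMeasure n ρ)) ν₁)
    (hac₂ : ν₂ ≪ radialMeasure n ρ) (hllr₂ : Integrable (llr ν₂ (radialMeasure n ρ)) ν₂)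
    (R : ℝ) {ε : ℝ} (hε : 0 < ε) :
    transportCost (fun x y => ENNReal.ofReal (radialCost ρ x y)) ν₁ ν₂ ≤
      ENNReal.ofReal (∫ x, llr ν₁ (radialMeasure n ρ) x ∂ν₁ +
        ∫ x, llr ν₂ (radialMeasure n ρ) x ∂ν₂) + ENNReal.ofReal ε +
      (2 * ∫⁻ z in {z | R < ‖z‖}, ENNReal.ofReal (radialPotential ρ z) ∂ν₁ +
        2 * ∫⁻ z in {z | R < ‖z‖}, ENNReal.ofReal (radialPotential ρ z) ∂ν₂) := by
  obtain ⟨m, q, k, hq, hk0, hk, hkε⟩ := hρ.exists_quantized_cost R hε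
  obtain ⟨γ, hγ, hγk⟩ := hρ.exists_coupling_quantized hac₁ hllr₁ hac₂ hllr₂ hq hk0 hk
  have hS : MeasurableSet {z : EuclideanSpace ℝ (Fin n) | R < ‖z‖} :=
    (isOpen_lt continuous_const continuous_norm).measurableSet
  set T := {z : EuclideanSpace ℝ (Fin n) | R < ‖z‖}.indicator
    fun z => ENNReal.ofReal (radialPotential ρ z) with hT_def
  have hT : Measurable T :=
    hρ.continuous_radialPotential.measurable.ennreal_ofReal.indicator hS
  have hT₁ : ∫⁻ p, 2 * T p.1 ∂γ = 2 * ∫⁻ z, T z ∂ν₁ := by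
    rw [lintegral_const_mul _ (by exact hT.comp measurable_fst), ← hγ.1,
      lintegral_map hT measurable_fst]
  have hT₂ : ∫⁻ p, 2 * T p.2 ∂γ = 2 * ∫⁻ z, T z ∂ν₂ := by
    rw [lintegral_const_mul _ (by exact hT.comp measurable_snd), ← hγ.2,
      lintegral_map hT measurable_snd]
  have hu : γ univ = 1 := by
    rw [← measure_univ (μ := ν₁), ← hγ.1, Measure.map_apply measurable_fst MeasurableSet.univ,
      preimage_univ]
  have hm₂ : Measurable fun p : EuclideanSpace ℝ (Fin n) × EuclideanSpace ℝ (Fin n) =>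
      2 * T p.2 := (hT.comp measurable_snd).const_mul 2
  have hm₁ : Measurable fun p : EuclideanSpace ℝ (Fin n) × EuclideanSpace ℝ (Fin n) =>
      2 * T p.1 := (hT.comp measurable_fst).const_mul 2
  calc transportCost (fun x y => ENNReal.ofReal (radialCost ρ x y)) ν₁ ν₂
      ≤ ∫⁻ p, ENNReal.ofReal (radialCost ρ p.1 p.2) ∂γ := iInf₂_le γ hγ
    _ ≤ ∫⁻ p, (ENNReal.ofReal (k (q p.1) (q p.2)) + ENNReal.ofReal ε +
          (2 * T p.1 + 2 * T p.2)) ∂γ :=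
        lintegral_mono fun p => hρ.ofReal_radialCost_le (hkε p.1 p.2)
    _ = ∫⁻ p, ENNReal.ofReal (k (q p.1) (q p.2)) ∂γ + ENNReal.ofReal ε +
          (2 * ∫⁻ z, T z ∂ν₁ + 2 * ∫⁻ z, T z ∂ν₂) := by
        rw [lintegral_add_right _ (by exact hm₁.add hm₂), lintegral_add_right _ measurable_const,
          lintegral_add_right _ hm₂, lintegral_const, hu, mul_one, hT₁, hT₂]
    _ ≤ _ := by
        rw [hT_def, lintegral_indicator hS, lintegral_indicator hS]
        exact add_le_add (add_le_add hγk le_rfl) le_rfl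

theorem tendsto_setLIntegral_radialPotential (hρ : IsRadialWeight n ρ)
    {ν : Measure (EuclideanSpace ℝ (Fin n))} [IsProbabilityMeasure ν]
    (hac : ν ≪ radialMeasure n ρ) (hllr : Integrable (llr ν (radialMeasure n ρ)) ν) :
    Tendsto (fun m : ℕ => ∫⁻ z in {z | (m : ℝ) < ‖z‖}, ENNReal.ofReal (radialPotential ρ z) ∂ν)
      atTop (𝓝 0) := by
  have := hρ.isProbabilityMeasure_radialMeasure
  obtain ⟨l, hl, h_int⟩ := hρ.exists_integrable_exp
  refine tendsto_setLIntegral_zero (lintegral_ofReal_ne_top_of_integrable_exp hac hllr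
    hρ.continuous_radialPotential.measurable hρ.radialPotential_nonneg hl h_int) ?_
  have hempty : ⋂ m : ℕ, {z : EuclideanSpace ℝ (Fin n) | (m : ℝ) < ‖z‖} = ∅ := by
    refine eq_empty_of_forall_notMem fun z hz => ?_
    obtain ⟨m, hm⟩ := exists_nat_ge ‖z‖
    exact hm.not_gt (mem_iInter.1 hz m)
  have h := tendsto_measure_iInter_atTop (μ := ν)
    (s := fun m : ℕ => {z : EuclideanSpace ℝ (Fin n) | (m : ℝ) < ‖z‖})
    (fun m => (isOpen_lt continuous_const continuous_norm).measurableSet.nullMeasurableSet)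
    (fun i j hij z (hz : (j : ℝ) < ‖z‖) => lt_of_le_of_lt (Nat.cast_le.2 hij : (i : ℝ) ≤ j) hz)
    ⟨0, measure_ne_top _ _⟩
  rwa [hempty, measure_empty] at h

theorem transportCost_le_relEnt_add_relEnt (hρ : IsRadialWeight n ρ)
    (ν₁ ν₂ : Measure (EuclideanSpace ℝ (Fin n))) [IsProbabilityMeasure ν₁]
    [IsProbabilityMeasure ν₂] :
    transportCost (fun x y => ENNReal.ofReal (radialCost ρ x y)) ν₁ ν₂ ≤
      relEnt ν₁ (radialMeasure n ρ) + relEnt ν₂ (radialMeasure n ρ) := by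
  rw [relEnt, relEnt]
  split_ifs with h₁ h₂ h₂
  · refine le_trans ?_ ENNReal.ofReal_add_le
    have ht : Tendsto (fun m : ℕ => ENNReal.ofReal (1 / ((m : ℝ) + 1))) atTop (𝓝 0) := by
      simpa [Function.comp_def] using (ENNReal.continuous_ofReal.tendsto 0).comp
        (tendsto_one_div_add_atTop_nhds_zero_nat (𝕜 := ℝ))
    have hlim := (ht.const_add (ENNReal.ofReal (∫ x, llr ν₁ (radialMeasure n ρ) x ∂ν₁ +
        ∫ x, llr ν₂ (radialMeasure n ρ) x ∂ν₂))).add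
      ((ENNReal.Tendsto.const_mul (a := 2) (hρ.tendsto_setLIntegral_radialPotential h₁.1 h₁.2)
        (.inr ENNReal.ofNat_ne_top)).add
        (ENNReal.Tendsto.const_mul (a := 2) (hρ.tendsto_setLIntegral_radialPotential h₂.1 h₂.2)
        (.inr ENNReal.ofNat_ne_top)))
    simp only [mul_zero, add_zero] at hlim
    exact ge_of_tendsto' hlim fun m => hρ.transportCost_le_add_tails h₁.1 h₁.2 h₂.1 h₂.2 m
      Nat.one_div_pos_of_nat
  all_goals simp

end IsRadialWeight

/-- Transport-entropy inequality for rotationally invariant measures, with the cost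
`ω̃_ρ(x,y) = log (ρ(|x·y|)² / (ρ(|x|²)ρ(|y|²)))`: if `ρ : [0,∞) → (0,∞)` is continuous,
nonincreasing, with `x ↦ ρ(|x|²)` integrable and `t ↦ −log ρ(eᵗ)` convex, and `μ_ρ` is the
probability measure with density proportional to `ρ(|x|²)`, then for all probability
measures `ν₁, ν₂`, `T_{ω̃_ρ}(ν₁,ν₂) ≤ H(ν₁|μ_ρ) + H(ν₂|μ_ρ)`. -/
theorem transport_entropy_general (n : ℕ) (ρ : ℝ → ℝ)
    (hρpos : ∀ t : ℝ, 0 ≤ t → 0 < ρ t)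
    (hρcont : ContinuousOn ρ (Set.Ici 0))
    (hρanti : AntitoneOn ρ (Set.Ici 0))
    (hρint : Integrable (fun x : EuclideanSpace ℝ (Fin n) => ρ (‖x‖ ^ 2)))
    (hρconv : ConvexOn ℝ Set.univ (fun t : ℝ => -Real.log (ρ (Real.exp t))))
    (μρ : Measure (EuclideanSpace ℝ (Fin n)))
    (hμρ : μρ = volume.withDensity (fun x =>
      ENNReal.ofReal (ρ (‖x‖ ^ 2) / ∫ y : EuclideanSpace ℝ (Fin n), ρ (‖y‖ ^ 2))))
    (ν₁ ν₂ : Measure (EuclideanSpace ℝ (Fin n)))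
    [IsProbabilityMeasure ν₁] [IsProbabilityMeasure ν₂] :
    transportCost
      (fun x y => ENNReal.ofReal
        (Real.log (ρ |⟪x, y⟫| ^ 2 / (ρ (‖x‖ ^ 2) * ρ (‖y‖ ^ 2))))) ν₁ ν₂
      ≤ relEnt ν₁ μρ + relEnt ν₂ μρ := by
  subst hμρ
  exact IsRadialWeight.transportCost_le_relEnt_add_relEnt
    ⟨hρpos, hρcont, hρanti, hρint, hρconv⟩ ν₁ ν₂
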